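/- Let ψ be a smooth global finite-energy 1-equivariant wave map and let A : (0,∞) → (0,∞) be increasing with A(t) → ∞ as t → ∞ and A(t) ≤ t for all t. Then there exists a sequence t_n → ∞ such that lim_{n→∞} sup_{σ>0} (1/σ) ∫_{t_n}^{t_n+σ} ∫₀^{t−A(t_n)} (∂_tψ)²(t,r) r dr dt = 0. -/

import Mathlib

open MeasureTheory Real Filter Set

noncomputable section

/-- The ground state harmonic map `Q(r) = 2 arctan r`. -/
def Q (r : ℝ) : ℝ := 2 * Real.arctan r

/-- Time derivative `∂ₜψ(t,r)`. -/
def pT (ψ : ℝ → ℝ → ℝ) (t r : ℝ) : ℝ := deriv (fun s => ψ s r) t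

/-- Radial derivative `∂ᵣψ(t,r)`. -/
def pR (ψ : ℝ → ℝ → ℝ) (t r : ℝ) : ℝ := deriv (fun ρ => ψ t ρ) r

/-- Energy density `((∂ₜψ)² + (∂ᵣψ)² + sin²ψ/r²) · r`. -/
def eDen (ψ : ℝ → ℝ → ℝ) (t r : ℝ) : ℝ :=
  ((pT ψ t r) ^ 2 + (pR ψ t r) ^ 2 + (Real.sin (ψ t r)) ^ 2 / r ^ 2) * r

/-- Localized energy `E_{r₁}^{r₂}(ψ⃗(t))`. -/
def locE (ψ : ℝ → ℝ → ℝ) (t r₁ r₂ : ℝ) : ℝ := ∫ r in Set.Ioc r₁ r₂, eDen ψ t r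

/-- Total energy `E(ψ⃗(t))`. -/
def totE (ψ : ℝ → ℝ → ℝ) (t : ℝ) : ℝ := ∫ r in Set.Ioi (0:ℝ), eDen ψ t r

/-- `ψ` is a smooth global 1-equivariant wave map on `[0,∞) × (0,∞)`. -/
def IsWaveMap (ψ : ℝ → ℝ → ℝ) : Prop :=
  ContDiffOn ℝ (⊤ : ℕ∞) (fun p : ℝ × ℝ => ψ p.1 p.2) (Set.Ici (0:ℝ) ×ˢ Set.Ioi (0:ℝ)) ∧
  ∀ t r : ℝ, 0 ≤ t → 0 < r →
    deriv (fun s => pT ψ s r) t - deriv (fun ρ => pR ψ t ρ) r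
      - (1 / r) * pR ψ t r + Real.sin (2 * ψ t r) / (2 * r ^ 2) = 0

/-- Finite energy: the energy density is integrable at each time `t ≥ 0`. -/
def FiniteEnergy (ψ : ℝ → ℝ → ℝ) : Prop :=
  ∀ t : ℝ, 0 ≤ t → MeasureTheory.IntegrableOn (eDen ψ t) (Set.Ioi 0) volume

/-- The energy is conserved. -/
def EnergyConserved (ψ : ℝ → ℝ → ℝ) : Prop :=
  ∀ t : ℝ, 0 ≤ t → totE ψ t = totE ψ 0

/-- Squared `H × L²` norm density `(ψ₁² + (∂ᵣψ₀)² + ψ₀²/r²) · r`. -/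
def hl2Den (f g : ℝ → ℝ) (r : ℝ) : ℝ :=
  ((g r) ^ 2 + (deriv f r) ^ 2 + (f r) ^ 2 / r ^ 2) * r

/-- Squared `H × L²` norm of the pair `(f, g)` over the set of radii `S`. -/
def hl2Sq (f g : ℝ → ℝ) (S : Set ℝ) : ℝ := ∫ r in S, hl2Den f g r

/-- Squared `H` norm of `f` over the set of radii `S`. -/
def hSq (f : ℝ → ℝ) (S : Set ℝ) : ℝ :=
  ∫ r in S, ((deriv f r) ^ 2 + (f r) ^ 2 / r ^ 2) * r

/-- Squared (radial) `L²` norm. -/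
def l2Sq (g : ℝ → ℝ) : ℝ := ∫ r in Set.Ioi (0:ℝ), (g r) ^ 2 * r

/-- Wave map energy of a pair of data `(f, g)`. -/
def pairE (f g : ℝ → ℝ) : ℝ :=
  ∫ r in Set.Ioi (0:ℝ), ((g r) ^ 2 + (deriv f r) ^ 2 + (Real.sin (f r)) ^ 2 / r ^ 2) * r

/-- `φ` is a smooth solution of the linearized equation
`φ_tt − φ_rr − (1/r) φ_r + φ/r² = 0` on `ℝ × (0,∞)`. -/
def IsLinearWave (φ : ℝ → ℝ → ℝ) : Prop :=
  ContDiffOn ℝ (⊤ : ℕ∞) (fun p : ℝ × ℝ => φ p.1 p.2) (Set.univ ×ˢ Set.Ioi (0:ℝ)) ∧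
  ∀ t r : ℝ, 0 < r →
    deriv (fun s => pT φ s r) t - deriv (fun ρ => pR φ t ρ) r
      - (1 / r) * pR φ t r + φ t r / r ^ 2 = 0

/-- A linear wave has finite energy: its `H × L²` density is integrable at each time. -/
def LinFiniteEnergy (φ : ℝ → ℝ → ℝ) : Prop :=
  ∀ t : ℝ, MeasureTheory.IntegrableOn (hl2Den (φ t) (pT φ t)) (Set.Ioi 0) volume

/-- Degree one boundary conditions: `ψ(t,0⁺) = 0`, `ψ(t,∞) = π`. -/
def DegreeOneBC (ψ : ℝ → ℝ → ℝ) : Prop :=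
  ∀ t : ℝ, 0 ≤ t →
    Filter.Tendsto (ψ t) (nhdsWithin 0 (Set.Ioi 0)) (nhds 0) ∧
    Filter.Tendsto (ψ t) Filter.atTop (nhds Real.pi)

/-- Degree zero boundary conditions: `φ(t,0⁺) = 0`, `φ(t,∞) = 0`. -/
def DegreeZeroBC (φ : ℝ → ℝ → ℝ) : Prop :=
  ∀ t : ℝ, 0 ≤ t →
    Filter.Tendsto (φ t) (nhdsWithin 0 (Set.Ioi 0)) (nhds 0) ∧
    Filter.Tendsto (φ t) Filter.atTop (nhds 0)


/-- The open quadrant of positive times and radii. -/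
def quadrant : Set (ℝ × ℝ) := Ioi 0 ×ˢ Ioi 0

/-- Smoothness of a function of time and radius on the open quadrant. -/
def SmoothOnQuadrant (g : ℝ → ℝ → ℝ) : Prop :=
  ContDiffOn ℝ (⊤ : ℕ∞) (fun p : ℝ × ℝ => g p.1 p.2) quadrant

theorem isOpen_quadrant : IsOpen quadrant := isOpen_Ioi.prod isOpen_Ioi

theorem mem_quadrant {t r : ℝ} (ht : 0 < t) (hr : 0 < r) : (t, r) ∈ quadrant := ⟨ht, hr⟩

theorem quadrant_mem_nhds {t r : ℝ} (ht : 0 < t) (hr : 0 < r) : quadrant ∈ nhds (t, r) :=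
  isOpen_quadrant.mem_nhds (mem_quadrant ht hr)

namespace SmoothOnQuadrant

variable {g h : ℝ → ℝ → ℝ}

theorem differentiableAt (hg : SmoothOnQuadrant g) {t r : ℝ} (ht : 0 < t) (hr : 0 < r) :
    DifferentiableAt ℝ (fun p : ℝ × ℝ => g p.1 p.2) (t, r) :=
  (hg.contDiffAt (quadrant_mem_nhds ht hr)).differentiableAt (by simp)

theorem hasDerivAt_comp (hg : SmoothOnQuadrant g) {t r : ℝ} (ht : 0 < t) (hr : 0 < r)
    {x y : ℝ → ℝ} {x' y' s : ℝ} (hx : HasDerivAt x x' s) (hy : HasDerivAt y y' s)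
    (hxs : x s = t) (hys : y s = r) :
    HasDerivAt (fun σ => g (x σ) (y σ))
      (fderiv ℝ (fun p : ℝ × ℝ => g p.1 p.2) (t, r) (x', y')) s := by
  have h1 := (hg.differentiableAt ht hr).hasFDerivAt
  have h2 : HasDerivAt (fun σ => (x σ, y σ)) (x', y') s := hx.prodMk hy
  subst hxs hys
  exact h1.comp_hasDerivAt s h2

theorem fderiv_time (hg : SmoothOnQuadrant g) {t r : ℝ} (ht : 0 < t) (hr : 0 < r) :
    fderiv ℝ (fun p : ℝ × ℝ => g p.1 p.2) (t, r) (1, 0) = pT g t r :=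
  (hg.hasDerivAt_comp ht hr (hasDerivAt_id t) (hasDerivAt_const t r) rfl rfl).deriv.symm

theorem fderiv_radial (hg : SmoothOnQuadrant g) {t r : ℝ} (ht : 0 < t) (hr : 0 < r) :
    fderiv ℝ (fun p : ℝ × ℝ => g p.1 p.2) (t, r) (0, 1) = pR g t r :=
  (hg.hasDerivAt_comp ht hr (hasDerivAt_const r t) (hasDerivAt_id r) rfl rfl).deriv.symm

theorem hasDerivAt_curve (hg : SmoothOnQuadrant g) {t r : ℝ} (ht : 0 < t) (hr : 0 < r)
    {x y : ℝ → ℝ} {x' y' s : ℝ} (hx : HasDerivAt x x' s) (hy : HasDerivAt y y' s)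
    (hxs : x s = t) (hys : y s = r) :
    HasDerivAt (fun σ => g (x σ) (y σ)) (x' * pT g t r + y' * pR g t r) s := by
  have h1 := hg.hasDerivAt_comp ht hr hx hy hxs hys
  have h2 : ((x', y') : ℝ × ℝ) = x' • ((1, 0) : ℝ × ℝ) + y' • ((0, 1) : ℝ × ℝ) := by simp
  rw [h2, map_add, map_smul, map_smul, hg.fderiv_time ht hr, hg.fderiv_radial ht hr] at h1
  simpa using h1

theorem hasDerivAt_time (hg : SmoothOnQuadrant g) {t r : ℝ} (ht : 0 < t) (hr : 0 < r) :
    HasDerivAt (fun s => g s r) (pT g t r) t := by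
  simpa using hg.hasDerivAt_curve ht hr (hasDerivAt_id t) (hasDerivAt_const t r) rfl rfl

theorem hasDerivAt_radial (hg : SmoothOnQuadrant g) {t r : ℝ} (ht : 0 < t) (hr : 0 < r) :
    HasDerivAt (fun ρ => g t ρ) (pR g t r) r := by
  simpa using hg.hasDerivAt_curve ht hr (hasDerivAt_const r t) (hasDerivAt_id r) rfl rfl

theorem contDiffOn_fderiv (hg : SmoothOnQuadrant g) :
    ContDiffOn ℝ (⊤ : ℕ∞) (fderiv ℝ (fun p : ℝ × ℝ => g p.1 p.2)) quadrant :=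
  hg.fderiv_of_isOpen isOpen_quadrant (by simp)

theorem time (hg : SmoothOnQuadrant g) : SmoothOnQuadrant (pT g) :=
  (hg.contDiffOn_fderiv.clm_apply contDiffOn_const).congr fun p hp =>
    (hg.fderiv_time (t := p.1) (r := p.2) hp.1 hp.2).symm

theorem radial (hg : SmoothOnQuadrant g) : SmoothOnQuadrant (pR g) :=
  (hg.contDiffOn_fderiv.clm_apply contDiffOn_const).congr fun p hp =>
    (hg.fderiv_radial (t := p.1) (r := p.2) hp.1 hp.2).symm

theorem time_radial_comm (hg : SmoothOnQuadrant g) {t r : ℝ} (ht : 0 < t) (hr : 0 < r) :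
    pT (pR g) t r = pR (pT g) t r := by
  set G := fun p : ℝ × ℝ => g p.1 p.2 with hG
  have hF : DifferentiableAt ℝ (fderiv ℝ G) (t, r) :=
    (hg.contDiffOn_fderiv.contDiffAt (quadrant_mem_nhds ht hr)).differentiableAt (by simp)
  have key : ∀ v w : ℝ × ℝ, fderiv ℝ (fun p => fderiv ℝ G p v) (t, r) w
      = fderiv ℝ (fderiv ℝ G) (t, r) w v := fun v w => by
    rw [(hF.hasFDerivAt.clm_apply (hasFDerivAt_const v _)).fderiv]
    simp
  have e1 : (fun p : ℝ × ℝ => pR g p.1 p.2) =ᶠ[nhds (t, r)] fun p => fderiv ℝ G p (0, 1) := by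
    filter_upwards [quadrant_mem_nhds ht hr] with p hp
    exact (hg.fderiv_radial (t := p.1) (r := p.2) hp.1 hp.2).symm
  have e2 : (fun p : ℝ × ℝ => pT g p.1 p.2) =ᶠ[nhds (t, r)] fun p => fderiv ℝ G p (1, 0) := by
    filter_upwards [quadrant_mem_nhds ht hr] with p hp
    exact (hg.fderiv_time (t := p.1) (r := p.2) hp.1 hp.2).symm
  rw [← hg.radial.fderiv_time ht hr, ← hg.time.fderiv_radial ht hr, e1.fderiv_eq, e2.fderiv_eq,
    key, key]
  refine second_derivative_symmetric_of_eventually_of_real (f := G) ?_ hF.hasFDerivAt _ _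
  filter_upwards [quadrant_mem_nhds ht hr] with p hp
  exact (hg.differentiableAt (t := p.1) (r := p.2) hp.1 hp.2).hasFDerivAt

theorem add (hg : SmoothOnQuadrant g) (hh : SmoothOnQuadrant h) :
    SmoothOnQuadrant (fun t r => g t r + h t r) := ContDiffOn.add hg hh

theorem sub (hg : SmoothOnQuadrant g) (hh : SmoothOnQuadrant h) :
    SmoothOnQuadrant (fun t r => g t r - h t r) := ContDiffOn.sub hg hh

theorem mul (hg : SmoothOnQuadrant g) (hh : SmoothOnQuadrant h) :
    SmoothOnQuadrant (fun t r => g t r * h t r) := ContDiffOn.mul hg hh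

theorem pow (hg : SmoothOnQuadrant g) (n : ℕ) :
    SmoothOnQuadrant (fun t r => g t r ^ n) := ContDiffOn.pow hg n

theorem const (c : ℝ) : SmoothOnQuadrant (fun _ _ => c) := contDiffOn_const

theorem radius : SmoothOnQuadrant (fun _ r => r) := contDiffOn_snd

theorem sin (hg : SmoothOnQuadrant g) : SmoothOnQuadrant (fun t r => Real.sin (g t r)) :=
  ContDiffOn.sin hg

theorem div (hg : SmoothOnQuadrant g) (hh : SmoothOnQuadrant h)
    (h0 : ∀ t r, 0 < t → 0 < r → h t r ≠ 0) :
    SmoothOnQuadrant (fun t r => g t r / h t r) :=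
  ContDiffOn.div hg hh fun p hp => h0 p.1 p.2 hp.1 hp.2

theorem continuousOn (hg : SmoothOnQuadrant g) :
    ContinuousOn (fun p : ℝ × ℝ => g p.1 p.2) quadrant := ContDiffOn.continuousOn hg

theorem continuousOn_comp (hg : SmoothOnQuadrant g) {X : Type*} [TopologicalSpace X] {x y : X → ℝ}
    {S : Set X} (hx : ContinuousOn x S) (hy : ContinuousOn y S) (hx0 : ∀ s ∈ S, 0 < x s)
    (hy0 : ∀ s ∈ S, 0 < y s) : ContinuousOn (fun s => g (x s) (y s)) S :=
  hg.continuousOn.comp (hx.prodMk hy) fun s hs => mem_quadrant (hx0 s hs) (hy0 s hs)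

end SmoothOnQuadrant

/-- A finite energy wave map with conserved energy `E`, in terms of its restriction to positive
times. -/
structure IsEnergyWave (ψ : ℝ → ℝ → ℝ) (E : ℝ) : Prop where
  smooth : SmoothOnQuadrant ψ
  wave : ∀ t r : ℝ, 0 < t → 0 < r → pT (pT ψ) t r =
    pR (pR ψ) t r + (1 / r) * pR ψ t r - Real.sin (2 * ψ t r) / (2 * r ^ 2)
  integrable : ∀ t : ℝ, 0 < t → IntegrableOn (eDen ψ t) (Ioi 0) volume
  energy : ∀ t : ℝ, 0 < t → totE ψ t = E

theorem IsWaveMap.isEnergyWave {ψ : ℝ → ℝ → ℝ} (hwm : IsWaveMap ψ) (hfe : FiniteEnergy ψ)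
    (hcons : EnergyConserved ψ) : IsEnergyWave ψ (totE ψ 0) where
  smooth := hwm.1.mono (prod_mono Ioi_subset_Ici_self Subset.rfl)
  wave t r ht hr := by
    have h := hwm.2 t r ht.le hr
    simp only [pT, pR] at h ⊢
    linarith
  integrable t ht := hfe t ht.le
  energy t ht := hcons t ht.le

/-- The energy flux `2rψₜψᵣ` through circles of constant radius. -/
def eFlux (ψ : ℝ → ℝ → ℝ) (t r : ℝ) : ℝ := 2 * r * pT ψ t r * pR ψ t r

/-- The null form appearing in the equations for the outgoing and incoming energy densities. -/
def nullForm (ψ : ℝ → ℝ → ℝ) (t r : ℝ) : ℝ :=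
  (pR ψ t r) ^ 2 - (pT ψ t r) ^ 2 + (Real.sin (ψ t r)) ^ 2 / r ^ 2
    - 4 * Real.sin (ψ t r) * Real.cos (ψ t r) * pR ψ t r / r

/-- The radial momentum weighted by the radius. -/
def virialDen (ψ : ℝ → ℝ → ℝ) (t r : ℝ) : ℝ := r ^ 2 * pT ψ t r * pR ψ t r

/-- The radial flux in the virial identity. -/
def virialFlux (ψ : ℝ → ℝ → ℝ) (t r : ℝ) : ℝ :=
  r ^ 2 / 2 * ((pT ψ t r) ^ 2 + (pR ψ t r) ^ 2) - (Real.sin (ψ t r)) ^ 2 / 2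

/-- The kinetic energy density. -/
def kinDen (ψ : ℝ → ℝ → ℝ) (t r : ℝ) : ℝ := (pT ψ t r) ^ 2 * r

section Densities

variable {ψ : ℝ → ℝ → ℝ}

theorem SmoothOnQuadrant.eDen (h : SmoothOnQuadrant ψ) : SmoothOnQuadrant (eDen ψ) :=
  (((h.time.pow 2).add (h.radial.pow 2)).add ((h.sin.pow 2).div (radius.pow 2)
    fun _ _ _ hr => pow_ne_zero 2 hr.ne')).mul radius

theorem SmoothOnQuadrant.eFlux (h : SmoothOnQuadrant ψ) : SmoothOnQuadrant (eFlux ψ) :=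
  (((const 2).mul radius).mul h.time).mul h.radial

theorem SmoothOnQuadrant.virialDen (h : SmoothOnQuadrant ψ) : SmoothOnQuadrant (virialDen ψ) :=
  ((radius.pow 2).mul h.time).mul h.radial

theorem SmoothOnQuadrant.virialFlux (h : SmoothOnQuadrant ψ) : SmoothOnQuadrant (virialFlux ψ) :=
  (((radius.pow 2).div (const 2) fun _ _ _ _ => two_ne_zero).mul
    ((h.time.pow 2).add (h.radial.pow 2))).sub
    ((h.sin.pow 2).div (const 2) fun _ _ _ _ => two_ne_zero)

theorem SmoothOnQuadrant.kinDen (h : SmoothOnQuadrant ψ) : SmoothOnQuadrant (kinDen ψ) :=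
  (h.time.pow 2).mul radius

theorem eDen_nonneg {t r : ℝ} (hr : 0 ≤ r) : 0 ≤ eDen ψ t r := by
  unfold eDen; positivity

theorem kinDen_nonneg {t r : ℝ} (hr : 0 ≤ r) : 0 ≤ kinDen ψ t r := by
  unfold kinDen; positivity

theorem kinDen_le_eDen {t r : ℝ} (hr : 0 ≤ r) : kinDen ψ t r ≤ eDen ψ t r := by
  unfold kinDen eDen
  have : 0 ≤ (pR ψ t r) ^ 2 + (Real.sin (ψ t r)) ^ 2 / r ^ 2 := by positivity
  gcongr
  linarith

theorem abs_eFlux_le {t r : ℝ} (hr : 0 ≤ r) : |eFlux ψ t r| ≤ eDen ψ t r := by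
  have h : 0 ≤ (Real.sin (ψ t r)) ^ 2 / r ^ 2 * r := by positivity
  unfold eFlux eDen
  rw [abs_le]
  constructor
  · nlinarith [mul_nonneg hr (sq_nonneg (pT ψ t r + pR ψ t r))]
  · nlinarith [mul_nonneg hr (sq_nonneg (pT ψ t r - pR ψ t r))]

theorem sin_sq_div_le_eDen {t r : ℝ} (hr : 0 < r) : (Real.sin (ψ t r)) ^ 2 / r ≤ eDen ψ t r := by
  have h : (Real.sin (ψ t r)) ^ 2 / r = (Real.sin (ψ t r)) ^ 2 / r ^ 2 * r := by
    field_simp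
  unfold eDen
  rw [h]
  gcongr
  nlinarith [sq_nonneg (pT ψ t r), sq_nonneg (pR ψ t r)]

theorem abs_nullForm_sq_le {t r : ℝ} (hr : 0 < r) :
    (nullForm ψ t r * r) ^ 2 ≤
      25 * ((eDen ψ t r + eFlux ψ t r) * (eDen ψ t r - eFlux ψ t r)) := by
  unfold nullForm eDen eFlux
  set p := pT ψ t r
  set q := pR ψ t r
  have hc : (Real.cos (ψ t r)) ^ 2 = 1 - (Real.sin (ψ t r)) ^ 2 := Real.cos_sq' _
  have hc1 : (Real.cos (ψ t r)) ^ 2 ≤ 1 := Real.cos_sq_le_one _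
  set s := Real.sin (ψ t r)
  set c := Real.cos (ψ t r)
  obtain ⟨w, hw⟩ : ∃ w, s = w * r := ⟨s / r, by field_simp⟩
  have e1 : (q ^ 2 - p ^ 2 + s ^ 2 / r ^ 2 - 4 * s * c * q / r) * r
      = r * (q ^ 2 - p ^ 2 + w ^ 2 - 4 * w * c * q) := by
    rw [hw]; field_simp
  have e2 : s ^ 2 / r ^ 2 = w ^ 2 := by rw [hw]; field_simp
  rw [e1, e2]
  have key : (q ^ 2 - p ^ 2 + w ^ 2 - 4 * w * c * q) ^ 2 ≤
      25 * ((p ^ 2 - q ^ 2) ^ 2 + 2 * w ^ 2 * (p ^ 2 + q ^ 2) + w ^ 4) := by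
    have h3 : ∀ x y z : ℝ, (x + y - z) ^ 2 ≤ 3 * (x ^ 2 + y ^ 2 + z ^ 2) := fun x y z => by
      nlinarith [sq_nonneg (x - y), sq_nonneg (x + z), sq_nonneg (y + z)]
    have h4 : (4 * w * c * q) ^ 2 ≤ 16 * (w ^ 2 * q ^ 2) := by
      nlinarith [mul_nonneg (sq_nonneg w) (sq_nonneg q)]
    nlinarith [h3 (q ^ 2 - p ^ 2) (w ^ 2) (4 * w * c * q), mul_nonneg (sq_nonneg w) (sq_nonneg q),
      mul_nonneg (sq_nonneg w) (sq_nonneg p), sq_nonneg (p ^ 2 - q ^ 2), sq_nonneg (w ^ 2)]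
  nlinarith [mul_le_mul_of_nonneg_left key (sq_nonneg r)]

end Densities

namespace IsEnergyWave

variable {ψ : ℝ → ℝ → ℝ} {E t r : ℝ}

theorem pT_eDen (h : IsEnergyWave ψ E) (ht : 0 < t) (hr : 0 < r) :
    pT (eDen ψ) t r = pR (eFlux ψ) t r := by
  have hp := h.smooth.time.hasDerivAt_time ht hr
  have hq := h.smooth.radial.hasDerivAt_time ht hr
  have hs := (h.smooth.hasDerivAt_time ht hr).sin
  have hp' := h.smooth.time.hasDerivAt_radial ht hr
  have hq' := h.smooth.radial.hasDerivAt_radial ht hr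
  have e1 := ((((hp.pow 2).add (hq.pow 2)).add ((hs.pow 2).div_const (r ^ 2))).mul_const r).deriv
  have e2 := ((((hasDerivAt_id r).const_mul 2).mul hp').mul hq').deriv
  have h1 : pT (eDen ψ) t r = _ := e1
  have h2 : pR (eFlux ψ) t r = _ := e2
  rw [h1, h2, h.wave t r ht hr, h.smooth.time_radial_comm ht hr, Real.sin_two_mul]
  simp
  field_simp
  ring

theorem pT_eFlux (h : IsEnergyWave ψ E) (ht : 0 < t) (hr : 0 < r) :
    pT (eFlux ψ) t r = pR (eDen ψ) t r + nullForm ψ t r := by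
  have hp := h.smooth.time.hasDerivAt_time ht hr
  have hq := h.smooth.radial.hasDerivAt_time ht hr
  have hs := (h.smooth.hasDerivAt_radial ht hr).sin
  have hp' := h.smooth.time.hasDerivAt_radial ht hr
  have hq' := h.smooth.radial.hasDerivAt_radial ht hr
  have e1 := ((hp.const_mul (2 * r)).mul hq).deriv
  have e2 := ((((hp'.pow 2).add (hq'.pow 2)).add ((hs.pow 2).div ((hasDerivAt_id r).pow 2)
    (pow_ne_zero 2 hr.ne'))).mul (hasDerivAt_id r)).deriv
  have h1 : pT (eFlux ψ) t r = _ := e1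
  have h2 : pR (eDen ψ) t r = _ := e2
  rw [h1, h2, h.wave t r ht hr, h.smooth.time_radial_comm ht hr, Real.sin_two_mul, nullForm]
  simp
  field_simp
  ring

theorem virial (h : IsEnergyWave ψ E) (ht : 0 < t) (hr : 0 < r) :
    kinDen ψ t r = pR (virialFlux ψ) t r - pT (virialDen ψ) t r := by
  have hp := h.smooth.time.hasDerivAt_time ht hr
  have hq := h.smooth.radial.hasDerivAt_time ht hr
  have hs := (h.smooth.hasDerivAt_radial ht hr).sin
  have hp' := h.smooth.time.hasDerivAt_radial ht hr
  have hq' := h.smooth.radial.hasDerivAt_radial ht hr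
  have e1 := ((hp.const_mul (r ^ 2)).mul hq).deriv
  have e2 := (((((hasDerivAt_id r).pow 2).div_const 2).mul ((hp'.pow 2).add (hq'.pow 2))).sub
    ((hs.pow 2).div_const 2)).deriv
  have h1 : pT (virialDen ψ) t r = _ := e1
  have h2 : pR (virialFlux ψ) t r = _ := e2
  rw [h1, h2, h.wave t r ht hr, h.smooth.time_radial_comm ht hr, Real.sin_two_mul, kinDen]
  simp
  field_simp
  ring

end IsEnergyWave

theorem intervalIntegral_swap_of_continuousOn {F : ℝ → ℝ → ℝ} {a b c d : ℝ}
    (h : ContinuousOn (fun p : ℝ × ℝ => F p.1 p.2) (uIcc a b ×ˢ uIcc c d)) :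
    ∫ x in a..b, ∫ y in c..d, F x y = ∫ y in c..d, ∫ x in a..b, F x y :=
  intervalIntegral_intervalIntegral_swap <|
    (h.integrableOn_compact (isCompact_uIcc.prod isCompact_uIcc)).mono_set
      (prod_mono uIoc_subset_uIcc uIoc_subset_uIcc)

theorem intervalIntegrable_intervalIntegral_of_continuousOn {F : ℝ → ℝ → ℝ} {a b c d : ℝ}
    (h : ContinuousOn (fun p : ℝ × ℝ => F p.1 p.2) (uIcc a b ×ˢ uIcc c d)) :
    IntervalIntegrable (fun x => ∫ y in c..d, F x y) volume a b := by
  have h1 := (h.integrableOn_compact (μ := volume)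
    (isCompact_uIcc.prod isCompact_uIcc)).mono_set
      (prod_mono (uIoc_subset_uIcc (a := a) (b := b)) (uIoc_subset_uIcc (a := c) (b := d)))
  rw [IntegrableOn, Measure.volume_eq_prod, ← Measure.prod_restrict] at h1
  rw [intervalIntegrable_iff]
  simp_rw [intervalIntegral.intervalIntegral_eq_integral_uIoc]
  have h2 := h1.integral_prod_left
  exact Integrable.smul (if c ≤ d then (1 : ℝ) else -1) h2

theorem pos_of_mem_uIcc {a b x : ℝ} (ha : 0 < a) (hb : 0 < b) (hx : x ∈ uIcc a b) : 0 < x :=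
  (lt_min ha hb).trans_le hx.1

namespace SmoothOnQuadrant

variable {g : ℝ → ℝ → ℝ}

theorem continuousOn_rect (hg : SmoothOnQuadrant g) {a b c d : ℝ} (ha : 0 < a) (hb : 0 < b)
    (hc : 0 < c) (hd : 0 < d) :
    ContinuousOn (fun p : ℝ × ℝ => g p.1 p.2) (uIcc a b ×ˢ uIcc c d) :=
  hg.continuousOn.mono fun _ hp => ⟨pos_of_mem_uIcc ha hb hp.1, pos_of_mem_uIcc hc hd hp.2⟩

theorem continuousOn_rect_swap (hg : SmoothOnQuadrant g) {a b c d : ℝ} (ha : 0 < a) (hb : 0 < b)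
    (hc : 0 < c) (hd : 0 < d) :
    ContinuousOn (fun p : ℝ × ℝ => (fun r t => g t r) p.1 p.2) (uIcc c d ×ˢ uIcc a b) :=
  hg.continuousOn_comp continuousOn_snd continuousOn_fst
    (fun _ hp => pos_of_mem_uIcc ha hb hp.2) fun _ hp => pos_of_mem_uIcc hc hd hp.1

theorem continuousOn_radial (hg : SmoothOnQuadrant g) {t : ℝ} (ht : 0 < t) :
    ContinuousOn (g t) (Ioi 0) :=
  hg.continuousOn_comp continuousOn_const continuousOn_id (fun _ _ => ht) fun _ h => h

theorem continuousOn_time (hg : SmoothOnQuadrant g) {r : ℝ} (hr : 0 < r) :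
    ContinuousOn (fun t => g t r) (Ioi 0) :=
  hg.continuousOn_comp continuousOn_id continuousOn_const (fun _ h => h) fun _ _ => hr

theorem intervalIntegrable_radial (hg : SmoothOnQuadrant g) {t a b : ℝ} (ht : 0 < t)
    (ha : 0 < a) (hb : 0 < b) : IntervalIntegrable (g t) volume a b :=
  ((hg.continuousOn_radial ht).mono fun _ hx => pos_of_mem_uIcc ha hb hx).intervalIntegrable

theorem intervalIntegrable_time (hg : SmoothOnQuadrant g) {r a b : ℝ} (hr : 0 < r)
    (ha : 0 < a) (hb : 0 < b) : IntervalIntegrable (fun t => g t r) volume a b :=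
  ((hg.continuousOn_time hr).mono fun _ hx => pos_of_mem_uIcc ha hb hx).intervalIntegrable

theorem integral_pT (hg : SmoothOnQuadrant g) {r a b : ℝ} (hr : 0 < r) (ha : 0 < a) (hb : 0 < b) :
    ∫ t in a..b, pT g t r = g b r - g a r :=
  intervalIntegral.integral_eq_sub_of_hasDerivAt
    (fun _ hx => hg.hasDerivAt_time (pos_of_mem_uIcc ha hb hx) hr)
    (hg.time.intervalIntegrable_time hr ha hb)

theorem integral_pR (hg : SmoothOnQuadrant g) {t a b : ℝ} (ht : 0 < t) (ha : 0 < a) (hb : 0 < b) :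
    ∫ r in a..b, pR g t r = g t b - g t a :=
  intervalIntegral.integral_eq_sub_of_hasDerivAt
    (fun _ hx => hg.hasDerivAt_radial ht (pos_of_mem_uIcc ha hb hx))
    (hg.radial.intervalIntegrable_radial ht ha hb)

/-- A conservation law integrated over a rectangle. -/
theorem integral_conservation {f : ℝ → ℝ → ℝ} (hg : SmoothOnQuadrant g) (hf : SmoothOnQuadrant f)
    (hgf : ∀ t r, 0 < t → 0 < r → pT g t r = pR f t r) {t₁ t₂ r₁ r₂ : ℝ} (ht₁ : 0 < t₁)
    (ht₂ : 0 < t₂) (hr₁ : 0 < r₁) (hr₂ : 0 < r₂) :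
    (∫ r in r₁..r₂, g t₂ r) - ∫ r in r₁..r₂, g t₁ r =
      (∫ t in t₁..t₂, f t r₂) - ∫ t in t₁..t₂, f t r₁ := by
  rw [← intervalIntegral.integral_sub (hg.intervalIntegrable_radial ht₂ hr₁ hr₂)
    (hg.intervalIntegrable_radial ht₁ hr₁ hr₂), ← intervalIntegral.integral_sub
    (hf.intervalIntegrable_time hr₂ ht₁ ht₂) (hf.intervalIntegrable_time hr₁ ht₁ ht₂)]
  have e1 : ∫ r in r₁..r₂, (g t₂ r - g t₁ r) = ∫ r in r₁..r₂, ∫ t in t₁..t₂, pR f t r :=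
    intervalIntegral.integral_congr fun r hr => by
      have hr0 := pos_of_mem_uIcc hr₁ hr₂ hr
      rw [← hg.integral_pT hr0 ht₁ ht₂]
      exact intervalIntegral.integral_congr fun t ht => hgf t r (pos_of_mem_uIcc ht₁ ht₂ ht) hr0
  have e2 : ∫ t in t₁..t₂, (f t r₂ - f t r₁) = ∫ t in t₁..t₂, ∫ r in r₁..r₂, pR f t r :=
    intervalIntegral.integral_congr fun t ht =>
      (hf.integral_pR (pos_of_mem_uIcc ht₁ ht₂ ht) hr₁ hr₂).symm
  rw [e1, e2, intervalIntegral_swap_of_continuousOn (F := fun t r => pR f t r)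
    (hf.radial.continuousOn_rect ht₁ ht₂ hr₁ hr₂)]

end SmoothOnQuadrant

namespace IsEnergyWave

variable {ψ : ℝ → ℝ → ℝ} {E t r : ℝ}

theorem locE_nonneg {r₁ r₂ : ℝ} (h : 0 ≤ r₁) : 0 ≤ locE ψ t r₁ r₂ :=
  setIntegral_nonneg measurableSet_Ioc fun _ hx => eDen_nonneg (h.trans hx.1.le)

theorem integrableOn_Ioc (h : IsEnergyWave ψ E) (ht : 0 < t) {a b : ℝ} (ha : 0 ≤ a) :
    IntegrableOn (eDen ψ t) (Ioc a b) volume :=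
  (h.integrable t ht).mono_set fun _ hx => ha.trans_lt hx.1

theorem locE_le (h : IsEnergyWave ψ E) (ht : 0 < t) (r : ℝ) : locE ψ t 0 r ≤ E := by
  rw [← h.energy t ht]
  exact setIntegral_mono_set (h.integrable t ht)
    (ae_restrict_of_forall_mem measurableSet_Ioi fun x hx => eDen_nonneg (le_of_lt hx))
    (Eventually.of_forall fun _ hx => hx.1)

theorem tendsto_locE_atTop (h : IsEnergyWave ψ E) (ht : 0 < t) :
    Tendsto (fun r => locE ψ t 0 r) atTop (nhds E) := by
  rw [← h.energy t ht]
  have := intervalIntegral_tendsto_integral_Ioi 0 (h.integrable t ht) tendsto_id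
  refine this.congr' ?_
  filter_upwards [eventually_ge_atTop 0] with r hr
  exact intervalIntegral.integral_of_le hr

theorem tendsto_locE_zero (h : IsEnergyWave ψ E) (ht : 0 < t) :
    Tendsto (fun r => locE ψ t 0 r) (nhdsWithin 0 (Ioi 0)) (nhds 0) := by
  have h1 : IntegrableOn (eDen ψ t) (uIcc 0 1) volume := by
    rw [uIcc_of_le zero_le_one, integrableOn_Icc_iff_integrableOn_Ioc]
    exact h.integrableOn_Ioc ht le_rfl
  have h2 : Tendsto (fun r => ∫ x in (0:ℝ)..r, eDen ψ t x) (nhdsWithin 0 (uIcc 0 1))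
      (nhds (∫ x in (0:ℝ)..0, eDen ψ t x)) :=
    (intervalIntegral.continuousOn_primitive_interval h1) 0 left_mem_uIcc
  rw [uIcc_of_le zero_le_one, intervalIntegral.integral_same] at h2
  have h4 := h2.mono_left (nhdsWithin_le_of_mem
    (mem_of_superset (Ioc_mem_nhdsGT (zero_lt_one' ℝ)) Ioc_subset_Icc_self))
  refine h4.congr' ?_
  filter_upwards [self_mem_nhdsWithin] with r hr
  exact intervalIntegral.integral_of_le (le_of_lt hr)

theorem locE_sub (h : IsEnergyWave ψ E) (ht : 0 < t) {r₁ r₂ : ℝ} (h₁ : 0 < r₁) (h₂ : 0 < r₂) :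
    locE ψ t 0 r₂ - locE ψ t 0 r₁ = ∫ r in r₁..r₂, eDen ψ t r := by
  have hi : ∀ r, 0 < r → IntervalIntegrable (eDen ψ t) volume 0 r := fun r hr =>
    (intervalIntegrable_iff_integrableOn_Ioc_of_le hr.le).2 (h.integrableOn_Ioc ht le_rfl)
  have e : ∀ r, 0 < r → locE ψ t 0 r = ∫ x in (0:ℝ)..r, eDen ψ t x := fun r hr =>
    (intervalIntegral.integral_of_le hr.le).symm
  rw [e _ h₁, e _ h₂, intervalIntegral.integral_interval_sub_left (hi _ h₂) (hi _ h₁)]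

theorem locE_mono (h : IsEnergyWave ψ E) (ht : 0 < t) {r₁ r₂ : ℝ} (h₁₂ : r₁ ≤ r₂) :
    locE ψ t 0 r₁ ≤ locE ψ t 0 r₂ :=
  setIntegral_mono_set (h.integrableOn_Ioc ht le_rfl)
    (ae_restrict_of_forall_mem measurableSet_Ioc fun _ hx => eDen_nonneg hx.1.le)
    (Eventually.of_forall fun _ hx => ⟨hx.1, hx.2.trans h₁₂⟩)

theorem hasDerivAt_locE_radial (h : IsEnergyWave ψ E) (ht : 0 < t) (hr : 0 < r) :
    HasDerivAt (fun ρ => locE ψ t 0 ρ) (eDen ψ t r) r := by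
  have hc := h.smooth.eDen.continuousOn_radial ht
  have h1 : HasDerivAt (fun ρ => locE ψ t 0 r + ∫ x in r..ρ, eDen ψ t x) (eDen ψ t r) r := by
    refine (intervalIntegral.integral_hasDerivAt_right (by simp) ?_ ?_).const_add _
    · exact hc.stronglyMeasurableAtFilter isOpen_Ioi r hr
    · exact hc.continuousAt (Ioi_mem_nhds hr)
  refine h1.congr_of_eventuallyEq ?_
  filter_upwards [Ioi_mem_nhds hr] with ρ hρ
  rw [← h.locE_sub ht hr hρ]
  ring

/-- A function converging at infinity whose absolute value has bounded integrals converges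
to zero. -/
theorem eq_zero_of_integral_abs_le {m : ℝ → ℝ} {κ C : ℝ} (hm : ContinuousOn m (Ioi 0))
    (hlim : Tendsto m atTop (nhds κ)) (hC : ∀ R, 1 ≤ R → ∫ r in (1:ℝ)..R, |m r| ≤ C) : κ = 0 := by
  by_contra hκ
  have hκ' : 0 < |κ| := abs_pos.2 hκ
  obtain ⟨R₀, hR₀⟩ := eventually_atTop.1 (hlim.abs.eventually_const_le (half_lt_self hκ'))
  set R₁ := max R₀ 1
  set R := R₁ + 2 * (|C| + 1) / |κ|
  have hR₁ : 1 ≤ R₁ := le_max_right _ _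
  have hRR : R₁ ≤ R := by simp only [R]; linarith [show 0 ≤ 2 * (|C| + 1) / |κ| by positivity]
  have hint : ∀ a b : ℝ, 1 ≤ a → 1 ≤ b → IntervalIntegrable (fun r => |m r|) volume a b :=
    fun a b ha hb => (hm.abs.mono fun x hx =>
      pos_of_mem_uIcc (by linarith) (by linarith) hx).intervalIntegrable
  have h1 : ∫ r in R₁..R, |κ| / 2 ≤ ∫ r in R₁..R, |m r| :=
    intervalIntegral.integral_mono_on hRR (by simp) (hint _ _ hR₁ (hR₁.trans hRR))
      fun x hx => hR₀ x ((le_max_left _ _).trans hx.1)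
  have h2 := intervalIntegral.integral_add_adjacent_intervals (hint 1 R₁ le_rfl hR₁)
    (hint R₁ R hR₁ (hR₁.trans hRR))
  have h3 : 0 ≤ ∫ r in (1:ℝ)..R₁, |m r| :=
    intervalIntegral.integral_nonneg hR₁ fun _ _ => abs_nonneg _
  have h4 := hC R (hR₁.trans hRR)
  rw [intervalIntegral.integral_const, smul_eq_mul] at h1
  have h5 : (R - R₁) * (|κ| / 2) = |C| + 1 := by simp only [R]; field_simp; ring
  linarith [le_abs_self C]

theorem locE_time_sub (h : IsEnergyWave ψ E) {t₁ t₂ : ℝ} (ht₁ : 0 < t₁) (ht₂ : 0 < t₂)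
    (h₁₂ : t₁ ≤ t₂) (hr : 0 < r) :
    locE ψ t₂ 0 r - locE ψ t₁ 0 r = ∫ t in t₁..t₂, eFlux ψ t r := by
  set m : ℝ → ℝ := fun r => ∫ t in t₁..t₂, eFlux ψ t r with hm
  have hcons : ∀ ρ, 0 < ρ → m ρ = m r - (locE ψ t₂ 0 r - locE ψ t₁ 0 r)
      + (locE ψ t₂ 0 ρ - locE ψ t₁ 0 ρ) := fun ρ hρ => by
    have e := h.smooth.eDen.integral_conservation h.smooth.eFlux
      (fun t r ht hr => h.pT_eDen ht hr) ht₁ ht₂ hr hρ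
    rw [← h.locE_sub ht₂ hr hρ, ← h.locE_sub ht₁ hr hρ] at e
    simp only [hm]
    linarith
  have hlim : Tendsto m atTop (nhds (m r - (locE ψ t₂ 0 r - locE ψ t₁ 0 r))) := by
    have h0 := ((h.tendsto_locE_atTop ht₂).sub (h.tendsto_locE_atTop ht₁)).const_add
      (m r - (locE ψ t₂ 0 r - locE ψ t₁ 0 r))
    rw [sub_self, add_zero] at h0
    refine h0.congr' ?_
    filter_upwards [eventually_gt_atTop 0] with ρ hρ
    exact (hcons ρ hρ).symm
  have hmc : ContinuousOn m (Ioi 0) := by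
    refine ContinuousOn.congr ?_ hcons
    exact continuousOn_const.add (ContinuousOn.sub
      (fun ρ hρ => (h.hasDerivAt_locE_radial ht₂ hρ).continuousAt.continuousWithinAt)
      (fun ρ hρ => (h.hasDerivAt_locE_radial ht₁ hρ).continuousAt.continuousWithinAt))
  have h0 := eq_zero_of_integral_abs_le (C := (t₂ - t₁) * E) hmc hlim fun R hR => by
    have hR0 : 0 < R := by linarith
    have hi := h.smooth.eDen.continuousOn_rect ht₁ ht₂ one_pos hR0
    calc ∫ ρ in (1:ℝ)..R, |m ρ| ≤ ∫ ρ in (1:ℝ)..R, ∫ t in t₁..t₂, eDen ψ t ρ := by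
          refine intervalIntegral.integral_mono_on hR ?_ ?_ fun ρ hρ => ?_
          · exact (hmc.abs.mono fun x hx => pos_of_mem_uIcc one_pos hR0 hx).intervalIntegrable
          · exact intervalIntegrable_intervalIntegral_of_continuousOn
              (h.smooth.eDen.continuousOn_rect_swap ht₁ ht₂ one_pos hR0)
          · have hρ0 : 0 < ρ := by linarith [hρ.1]
            refine (intervalIntegral.abs_integral_le_integral_abs h₁₂).trans ?_
            exact intervalIntegral.integral_mono_on h₁₂
              (h.smooth.eFlux.intervalIntegrable_time hρ0 ht₁ ht₂).abs
              (h.smooth.eDen.intervalIntegrable_time hρ0 ht₁ ht₂) fun t _ => abs_eFlux_le hρ0.le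
      _ = ∫ t in t₁..t₂, ∫ ρ in (1:ℝ)..R, eDen ψ t ρ :=
          (intervalIntegral_swap_of_continuousOn hi).symm
      _ ≤ ∫ t in t₁..t₂, E := by
          refine intervalIntegral.integral_mono_on h₁₂ ?_ (by simp) fun t ht => ?_
          · exact intervalIntegrable_intervalIntegral_of_continuousOn hi
          · have ht0 := ht₁.trans_le ht.1
            rw [← h.locE_sub ht0 one_pos hR0]
            linarith [h.locE_le ht0 R, locE_nonneg (ψ := ψ) (t := t) (r₂ := 1) le_rfl]
      _ = (t₂ - t₁) * E := by simp
  linarith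

end IsEnergyWave

/-- A bounded function of the null coordinates `0 < u < v`, nondecreasing in `v` and nonincreasing
in `u`, whose mixed derivative is controlled by its first derivatives. -/
structure IsNullPotential (J α β γ : ℝ → ℝ → ℝ) (E : ℝ) : Prop where
  hasDerivAt_v : ∀ u v, 0 < u → u < v → HasDerivAt (fun v => J u v) (α u v) v
  hasDerivAt_u : ∀ u v, 0 < u → u < v → HasDerivAt (fun u => J u v) (-β u v) u
  hasDerivAt_β : ∀ u v, 0 < u → u < v → HasDerivAt (fun v => β u v) (γ u v) v
  continuousOn_α : ContinuousOn (fun p : ℝ × ℝ => α p.1 p.2) {p | 0 < p.1 ∧ p.1 < p.2}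
  continuousOn_β : ContinuousOn (fun p : ℝ × ℝ => β p.1 p.2) {p | 0 < p.1 ∧ p.1 < p.2}
  continuousOn_γ : ContinuousOn (fun p : ℝ × ℝ => γ p.1 p.2) {p | 0 < p.1 ∧ p.1 < p.2}
  α_nonneg : ∀ u v, 0 < u → u < v → 0 ≤ α u v
  β_nonneg : ∀ u v, 0 < u → u < v → 0 ≤ β u v
  γ_sq_le : ∀ u v, 0 < u → u < v → (γ u v * (v - u)) ^ 2 ≤ 25 * (α u v * β u v)
  nonneg : ∀ u v, 0 < u → u < v → 0 ≤ J u v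
  le : ∀ u v, 0 < u → u < v → J u v ≤ E

namespace IsNullPotential

variable {J α β γ : ℝ → ℝ → ℝ} {E : ℝ}

theorem mono_v (h : IsNullPotential J α β γ E) {u v₁ v₂ : ℝ} (hu : 0 < u) (huv : u < v₁)
    (hv : v₁ ≤ v₂) : J u v₁ ≤ J u v₂ := by
  have hm : MonotoneOn (fun v => J u v) (Ioi u) := by
    refine monotoneOn_of_hasDerivWithinAt_nonneg (f' := fun v => α u v) (convex_Ioi u)
      (fun v hv => (h.hasDerivAt_v u v hu hv).continuousAt.continuousWithinAt) ?_ ?_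
    · intro v hv
      rw [interior_Ioi] at hv
      exact (h.hasDerivAt_v u v hu hv).hasDerivWithinAt
    · intro v hv
      rw [interior_Ioi] at hv
      exact h.α_nonneg u v hu hv
  exact hm huv (huv.trans_le hv) hv

theorem anti_u (h : IsNullPotential J α β γ E) {u₁ u₂ v : ℝ} (hu : 0 < u₁) (huu : u₁ ≤ u₂)
    (huv : u₂ < v) : J u₂ v ≤ J u₁ v := by
  have hm : AntitoneOn (fun u => J u v) (Ioo 0 v) := by
    refine antitoneOn_of_hasDerivWithinAt_nonpos (f' := fun u => -β u v) (convex_Ioo 0 v)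
      (fun u hu => (h.hasDerivAt_u u v hu.1 hu.2).continuousAt.continuousWithinAt) ?_ ?_
    · intro u hu
      rw [interior_Ioo] at hu
      exact (h.hasDerivAt_u u v hu.1 hu.2).hasDerivWithinAt
    · intro u hu
      rw [interior_Ioo] at hu
      exact neg_nonpos.2 (h.β_nonneg u v hu.1 hu.2)
  exact hm ⟨hu, huu.trans_lt huv⟩ ⟨hu.trans_le huu, huv⟩ huu

theorem exists_limit (h : IsNullPotential J α β γ E) :
    ∃ F : ℝ → ℝ, ∀ u, 0 < u → Tendsto (J u) atTop (nhds (F u)) := by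
  have : ∀ u, ∃ F : ℝ, 0 < u → Tendsto (J u) atTop (nhds F) := fun u => by
    by_cases hu : 0 < u
    · have hm : Monotone fun v => J u (max v (u + 1)) := fun v₁ v₂ hv =>
        h.mono_v hu ((lt_add_one u).trans_le (le_max_right _ _)) (max_le_max_right _ hv)
      have hb : BddAbove (range fun v => J u (max v (u + 1))) := by
        refine ⟨E, ?_⟩
        rintro _ ⟨v, rfl⟩
        exact h.le _ _ hu ((lt_add_one u).trans_le (le_max_right _ _))
      refine ⟨_, fun _ => (tendsto_atTop_ciSup hm hb).congr' ?_⟩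
      filter_upwards [eventually_ge_atTop (u + 1)] with v hv
      rw [max_eq_left hv]
    · exact ⟨0, fun h => absurd h hu⟩
  choose F hF using this
  exact ⟨F, hF⟩

theorem le_limit (h : IsNullPotential J α β γ E) {F : ℝ → ℝ}
    (hF : ∀ u, 0 < u → Tendsto (J u) atTop (nhds (F u))) {u v : ℝ} (hu : 0 < u) (huv : u < v) :
    J u v ≤ F u := by
  refine ge_of_tendsto (hF u hu) ?_
  filter_upwards [eventually_ge_atTop v] with w hw
  exact h.mono_v hu huv hw

theorem abs_γ_le (h : IsNullPotential J α β γ E) {c u v₀ v : ℝ} (hc0 : 0 < c) (hc1 : c < 1)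
    (hu : 0 < u) (huv : u ≤ c * v₀) (hv : v₀ ≤ v) :
    |γ u v| ≤ v₀ / (4 * v ^ 2) * β u v + 25 / (1 - c) ^ 2 / v₀ * α u v := by
  have hv₀ : 0 < v₀ := by
    by_contra hneg
    nlinarith
  have hv0 : 0 < v := hv₀.trans_le hv
  have hcv : u ≤ c * v := huv.trans (by gcongr)
  have huv' : u < v := by nlinarith
  have hα := h.α_nonneg u v hu huv'
  have hβ := h.β_nonneg u v hu huv'
  have h1c : 0 < 1 - c := by linarith
  refine abs_le_of_sq_le_sq ?_ (by positivity)
  have h1 : (γ u v) ^ 2 * ((1 - c) * v) ^ 2 ≤ 25 * (α u v * β u v) := by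
    refine le_trans ?_ (h.γ_sq_le u v hu huv')
    rw [mul_pow (γ u v)]
    refine mul_le_mul_of_nonneg_left (pow_le_pow_left₀ (by positivity) ?_ 2) (sq_nonneg _)
    linarith
  have h2 : (γ u v) ^ 2 ≤ 25 * (α u v * β u v) / ((1 - c) * v) ^ 2 :=
    (le_div_iff₀ (by positivity)).2 h1
  have h3 : 25 * (α u v * β u v) / ((1 - c) * v) ^ 2 =
      4 * (v₀ / (4 * v ^ 2) * β u v) * (25 / (1 - c) ^ 2 / v₀ * α u v) := by
    field_simp
  nlinarith [sq_nonneg (v₀ / (4 * v ^ 2) * β u v - 25 / (1 - c) ^ 2 / v₀ * α u v)]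

/-- The drop of the potential across a range of `u`, compared at two values of `v`. -/
theorem drop_le (h : IsNullPotential J α β γ E) {a c U v₀ v₁ M : ℝ} (ha : 0 < a) (haU : a ≤ U)
    (hc0 : 0 < c) (hc1 : c < 1) (hU : U ≤ c * v₀) (hv : v₀ ≤ v₁)
    (hM : ∀ v ∈ Icc v₀ v₁, J a v - J U v ≤ M) (hM0 : 0 ≤ M) :
    J a v₀ - J U v₀ ≤ J a v₁ - J U v₁ + M / 4 +
      25 / (1 - c) ^ 2 / v₀ * ∫ u in a..U, (J u v₁ - J u v₀) := by
  have hU0 : 0 < U := ha.trans_le haU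
  have hv₀ : 0 < v₀ := by
    by_contra hneg
    nlinarith
  have hv₁ : 0 < v₁ := hv₀.trans_le hv
  have hUv : U < v₀ := by nlinarith
  set K := 25 / (1 - c) ^ 2
  have hsub : uIcc a U ×ˢ uIcc v₀ v₁ ⊆ {p : ℝ × ℝ | 0 < p.1 ∧ p.1 < p.2} := by
    rintro ⟨u, v⟩ ⟨h1, h2⟩
    rw [uIcc_of_le haU] at h1
    rw [uIcc_of_le hv] at h2
    exact ⟨ha.trans_le h1.1, h1.2.trans_lt (hUv.trans_le h2.1)⟩
  have hmem : ∀ u ∈ Icc a U, ∀ v ∈ Icc v₀ v₁, 0 < u ∧ u < v := fun u hu v hv =>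
    ⟨ha.trans_le hu.1, hu.2.trans_lt (hUv.trans_le hv.1)⟩
  have slice_v : ∀ f : ℝ → ℝ → ℝ, ContinuousOn (fun p : ℝ × ℝ => f p.1 p.2)
      {p | 0 < p.1 ∧ p.1 < p.2} → ∀ u ∈ Icc a U, IntervalIntegrable (f u) volume v₀ v₁ :=
    fun f hf u hu => ContinuousOn.intervalIntegrable <|
      hf.comp (f := fun v => (u, v)) (by fun_prop) fun v hv' =>
        hmem u hu v (by rwa [uIcc_of_le hv] at hv')
  have slice_u : ∀ f : ℝ → ℝ → ℝ, ContinuousOn (fun p : ℝ × ℝ => f p.1 p.2)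
      {p | 0 < p.1 ∧ p.1 < p.2} → ∀ v ∈ Icc v₀ v₁,
      IntervalIntegrable (fun u => f u v) volume a U :=
    fun f hf v hv' => ContinuousOn.intervalIntegrable <|
      hf.comp (f := fun u => (u, v)) (by fun_prop) fun u hu =>
        hmem u (by rwa [uIcc_of_le haU] at hu) v hv'
  have hdrop : ∀ v ∈ Icc v₀ v₁, J a v - J U v = ∫ u in a..U, β u v := fun v hv' => by
    have := intervalIntegral.integral_eq_sub_of_hasDerivAt (f := fun u => J u v)
      (f' := fun u => -β u v) (a := a) (b := U)
      (fun u hu => h.hasDerivAt_u u v (hmem u (by rwa [uIcc_of_le haU] at hu) v hv').1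
        (hmem u (by rwa [uIcc_of_le haU] at hu) v hv').2)
      (slice_u _ h.continuousOn_β v hv').neg
    rw [intervalIntegral.integral_neg] at this
    linarith
  have hgain : ∀ u ∈ Icc a U, J u v₁ - J u v₀ = ∫ v in v₀..v₁, α u v := fun u hu =>
    (intervalIntegral.integral_eq_sub_of_hasDerivAt
      (fun v hv' => h.hasDerivAt_v u v (hmem u hu v (by rwa [uIcc_of_le hv] at hv')).1
        (hmem u hu v (by rwa [uIcc_of_le hv] at hv')).2)
      (slice_v _ h.continuousOn_α u hu)).symm
  have hβγ : ∀ u ∈ Icc a U, β u v₁ - β u v₀ = ∫ v in v₀..v₁, γ u v := fun u hu =>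
    (intervalIntegral.integral_eq_sub_of_hasDerivAt
      (fun v hv' => h.hasDerivAt_β u v (hmem u hu v (by rwa [uIcc_of_le hv] at hv')).1
        (hmem u hu v (by rwa [uIcc_of_le hv] at hv')).2)
      (slice_v _ h.continuousOn_γ u hu)).symm
  have hm₀ : v₀ ∈ Icc v₀ v₁ := left_mem_Icc.2 hv
  have hm₁ : v₁ ∈ Icc v₀ v₁ := right_mem_Icc.2 hv
  have hw : ContinuousOn (fun v : ℝ => v₀ / (4 * v ^ 2)) (uIcc v₀ v₁) := by
    refine ContinuousOn.div (by fun_prop) (by fun_prop) fun v hv' => ?_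
    have := pos_of_mem_uIcc hv₀ hv₁ hv'
    positivity
  have hwβ : ContinuousOn (fun p : ℝ × ℝ => v₀ / (4 * p.2 ^ 2) * β p.1 p.2)
      (uIcc a U ×ˢ uIcc v₀ v₁) :=
    (hw.comp continuousOn_snd fun p hp => hp.2).mul (h.continuousOn_β.mono hsub)
  have hwβ' : ContinuousOn (fun p : ℝ × ℝ => v₀ / (4 * p.1 ^ 2) * β p.2 p.1)
      (uIcc v₀ v₁ ×ˢ uIcc a U) :=
    (hw.comp continuousOn_fst fun p hp => hp.1).mul
      ((h.continuousOn_β.mono hsub).comp (f := fun p : ℝ × ℝ => (p.2, p.1)) (by fun_prop)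
        fun p hp => ⟨hp.2, hp.1⟩)
  have hpt : ∀ u ∈ Icc a U, β u v₀ - β u v₁ ≤
      (∫ v in v₀..v₁, v₀ / (4 * v ^ 2) * β u v) + K / v₀ * (J u v₁ - J u v₀) := fun u hu => by
    have hi1 : IntervalIntegrable (fun v => v₀ / (4 * v ^ 2) * β u v) volume v₀ v₁ :=
      (slice_v _ h.continuousOn_β u hu).continuousOn_mul hw
    have hi2 := (slice_v _ h.continuousOn_α u hu).const_mul (K / v₀)
    rw [hgain u hu, ← intervalIntegral.integral_const_mul, ← intervalIntegral.integral_add hi1 hi2,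
      ← neg_sub, hβγ u hu, ← intervalIntegral.integral_neg]
    refine intervalIntegral.integral_mono_on hv (slice_v _ h.continuousOn_γ u hu).neg
      (hi1.add hi2) fun v hv' => ?_
    exact (neg_le_abs _).trans
      (h.abs_γ_le hc0 hc1 (ha.trans_le hu.1) (hu.2.trans hU) hv'.1)
  have hJi : IntervalIntegrable (fun u => J u v₁ - J u v₀) volume a U := by
    refine ContinuousOn.intervalIntegrable fun u hu => ?_
    rw [uIcc_of_le haU] at hu
    exact ((h.hasDerivAt_u u v₁ (hmem u hu _ hm₁).1 (hmem u hu _ hm₁).2).continuousAt.sub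
      (h.hasDerivAt_u u v₀ (hmem u hu _ hm₀).1 (hmem u hu _ hm₀).2).continuousAt).continuousWithinAt
  have hi1 := intervalIntegrable_intervalIntegral_of_continuousOn
    (F := fun u v => v₀ / (4 * v ^ 2) * β u v) hwβ
  have hint : (J a v₀ - J U v₀) - (J a v₁ - J U v₁) ≤
      (∫ u in a..U, ∫ v in v₀..v₁, v₀ / (4 * v ^ 2) * β u v) +
        K / v₀ * ∫ u in a..U, (J u v₁ - J u v₀) := by
    rw [hdrop v₀ hm₀, hdrop v₁ hm₁, ← intervalIntegral.integral_sub
      (slice_u _ h.continuousOn_β _ hm₀) (slice_u _ h.continuousOn_β _ hm₁),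
      ← intervalIntegral.integral_const_mul, ← intervalIntegral.integral_add hi1
      (hJi.const_mul _)]
    exact intervalIntegral.integral_mono_on haU
      ((slice_u _ h.continuousOn_β _ hm₀).sub (slice_u _ h.continuousOn_β _ hm₁))
      (hi1.add (hJi.const_mul _)) hpt
  have hweight : ∫ v in v₀..v₁, v₀ / (4 * v ^ 2) = 1 / 4 - v₀ / (4 * v₁) := by
    have := intervalIntegral.integral_eq_sub_of_hasDerivAt (a := v₀) (b := v₁)
      (f := fun v => -(v₀ / 4) * v⁻¹) (f' := fun v => v₀ / (4 * v ^ 2)) (fun v hv' => by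
        have hv0 := pos_of_mem_uIcc hv₀ hv₁ hv'
        refine ((hasDerivAt_inv hv0.ne').const_mul (-(v₀ / 4))).congr_deriv ?_
        field_simp) hw.intervalIntegrable
    rw [this]
    field_simp
    ring
  have hswap : (∫ u in a..U, ∫ v in v₀..v₁, v₀ / (4 * v ^ 2) * β u v) ≤ M / 4 := by
    rw [intervalIntegral_swap_of_continuousOn (F := fun u v => v₀ / (4 * v ^ 2) * β u v) hwβ]
    calc ∫ v in v₀..v₁, ∫ u in a..U, v₀ / (4 * v ^ 2) * β u v
        ≤ ∫ v in v₀..v₁, v₀ / (4 * v ^ 2) * M := by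
          refine intervalIntegral.integral_mono_on hv ?_ (hw.intervalIntegrable.mul_const M)
            fun v hv' => ?_
          · exact intervalIntegrable_intervalIntegral_of_continuousOn
              (F := fun v u => v₀ / (4 * v ^ 2) * β u v) hwβ'
          · rw [intervalIntegral.integral_const_mul, ← hdrop v hv']
            have := hM v hv'
            gcongr
      _ = (1 / 4 - v₀ / (4 * v₁)) * M := by rw [intervalIntegral.integral_mul_const, hweight]
      _ ≤ M / 4 := by
          have : 0 ≤ v₀ / (4 * v₁) * M := by positivity
          linarith
  linarith

/-- A Grönwall type bound for the drop of the potential in `u`. -/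
theorem drop_le_of_limit (h : IsNullPotential J α β γ E) {F : ℝ → ℝ}
    (hF : ∀ u, 0 < u → Tendsto (J u) atTop (nhds (F u))) {a c δ v₀ : ℝ} (ha : 0 < a)
    (hc0 : 0 < c) (hc1 : c < 1) (hδ : ∀ u, a ≤ u → F a ≤ F u + δ) (hav : a ≤ c * v₀)
    {U : ℝ} (haU : a ≤ U) (hU : U ≤ c * v₀) :
    J a v₀ - J U v₀ ≤ 2 * (δ + 25 / (1 - c) ^ 2 * (F a - J a v₀)) *
      Real.exp (4 * (25 / (1 - c) ^ 2)) := by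
  have hv₀ : 0 < v₀ := by
    by_contra hneg
    nlinarith
  have hcv : c * v₀ < v₀ := by nlinarith
  have h1c : 0 < 1 - c := by linarith
  set K := 25 / (1 - c) ^ 2 with hK
  have hK0 : 0 < K := by positivity
  set f := F a - J a v₀ with hf
  have hf0 : 0 ≤ f := sub_nonneg.2 (h.le_limit hF ha (hav.trans_lt hcv))
  have hδ0 : 0 ≤ δ := by linarith [hδ a le_rfl]
  set D := δ + K * f with hD
  have hD0 : 0 ≤ D := by positivity
  set κ := 4 * K / v₀ with hκ
  have hκ0 : 0 < κ := by positivity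
  have step : ∀ S, 0 ≤ S → (∀ v, v₀ ≤ v → ∀ u ∈ Icc a (c * v₀),
      J a v - J u v ≤ S * Real.exp (κ * (u - a))) → ∀ v, v₀ ≤ v → ∀ u ∈ Icc a (c * v₀),
      J a v - J u v ≤ (D + S / 2) * Real.exp (κ * (u - a)) := by
    intro S hS hP v hv U hU
    have hv0 : 0 < v := hv₀.trans_le hv
    have hUv : U ≤ c * v := hU.2.trans (by gcongr)
    have hexp : 1 ≤ Real.exp (κ * (U - a)) :=
      Real.one_le_exp (mul_nonneg hκ0.le (sub_nonneg.2 hU.1))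
    have hbd : ∀ v₁, v ≤ v₁ → J a v - J U v ≤
        (J a v₁ - J U v₁) + (K * f + S / 2 * Real.exp (κ * (U - a))) := by
      intro v₁ hv₁
      have h1 := h.drop_le ha hU.1 hc0 hc1 hUv hv₁
        (fun w hw => hP w (hv.trans hw.1) U hU) (by positivity)
      have h2 : ∫ u in a..U, (J u v₁ - J u v) ≤ ∫ u in a..U, (f + S * Real.exp (κ * (u - a))) := by
        refine intervalIntegral.integral_mono_on hU.1 ?_ ?_ fun u hu => ?_
        · refine ContinuousOn.intervalIntegrable fun u hu => ?_
          rw [uIcc_of_le hU.1] at hu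
          have hu0 := ha.trans_le hu.1
          have huv : u < v := hu.2.trans_lt (hU.2.trans_lt (hcv.trans_le hv))
          exact ((h.hasDerivAt_u u v₁ hu0 (huv.trans_le hv₁)).continuousAt.sub
            (h.hasDerivAt_u u v hu0 huv).continuousAt).continuousWithinAt
        · exact (by fun_prop : Continuous fun u => f + S * Real.exp (κ * (u - a))).intervalIntegrable
            _ _
        · have huc : u ≤ c * v₀ := hu.2.trans hU.2
          have huv : u < v := huc.trans_lt (hcv.trans_le hv)
          have i1 := hP v hv u ⟨hu.1, huc⟩
          have i2 := h.mono_v ha (hav.trans_lt hcv) hv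
          have i3 := h.anti_u ha hu.1 (huv.trans_le hv₁)
          have i4 := h.le_limit hF ha (hu.1.trans_lt (huv.trans_le hv₁))
          linarith
      have h3 : ∫ u in a..U, (f + S * Real.exp (κ * (u - a))) =
          (U - a) * f + S * ((Real.exp (κ * (U - a)) - 1) / κ) := by
        have := intervalIntegral.integral_eq_sub_of_hasDerivAt (a := a) (b := U)
          (f := fun u => u * f + S * (Real.exp (κ * (u - a)) / κ))
          (f' := fun u => f + S * Real.exp (κ * (u - a))) (fun u _ => by
            have e := ((((hasDerivAt_id u).sub_const a).const_mul κ).exp.div_const κ).const_mul S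
            refine (((hasDerivAt_id u).mul_const f).add e).congr_deriv ?_
            field_simp
            simp)
          ((by fun_prop : Continuous fun u => f + S * Real.exp (κ * (u - a))).intervalIntegrable
            _ _)
        rw [this]
        simp
        ring
      have h4 : (U - a) * f + S * ((Real.exp (κ * (U - a)) - 1) / κ) ≤
          v₀ * f + S * Real.exp (κ * (U - a)) * v₀ / (4 * K) := by
        have i1 : (U - a) * f ≤ v₀ * f := by
          gcongr
          linarith [hU.2]
        have i2 : S * ((Real.exp (κ * (U - a)) - 1) / κ) ≤ S * (Real.exp (κ * (U - a)) / κ) := by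
          gcongr
          linarith
        have i3 : S * (Real.exp (κ * (U - a)) / κ) = S * Real.exp (κ * (U - a)) * v₀ / (4 * K) := by
          rw [hκ]
          field_simp
        linarith
      have h5 : K / v * ∫ u in a..U, (J u v₁ - J u v) ≤
          K / v₀ * (v₀ * f + S * Real.exp (κ * (U - a)) * v₀ / (4 * K)) := by
        have i1 : K / v * ∫ u in a..U, (J u v₁ - J u v) ≤
            K / v * (v₀ * f + S * Real.exp (κ * (U - a)) * v₀ / (4 * K)) := by
          gcongr
          linarith
        refine i1.trans ?_
        gcongr
      have h6 : K / v₀ * (v₀ * f + S * Real.exp (κ * (U - a)) * v₀ / (4 * K)) =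
          K * f + S * Real.exp (κ * (U - a)) / 4 := by
        field_simp
      linarith
    have hlim : J a v - J U v ≤ (F a - F U) + (K * f + S / 2 * Real.exp (κ * (U - a))) := by
      refine ge_of_tendsto (((hF a ha).sub (hF U (ha.trans_le hU.1))).add_const _) ?_
      filter_upwards [eventually_ge_atTop v] with v₁ hv₁
      exact hbd v₁ hv₁
    have := hδ U hU.1
    nlinarith
  have hE0 : 0 ≤ E := (h.nonneg a v₀ ha (hav.trans_lt hcv)).trans (h.le a v₀ ha (hav.trans_lt hcv))
  have iter : ∀ n : ℕ, ∀ v, v₀ ≤ v → ∀ u ∈ Icc a (c * v₀),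
      J a v - J u v ≤ (2 * D + E / 2 ^ n) * Real.exp (κ * (u - a)) := by
    intro n
    induction n with
    | zero =>
      intro v hv u hu
      have huv : u < v := hu.2.trans_lt (hcv.trans_le hv)
      have i1 := h.le a v ha (hu.1.trans_lt huv)
      have i2 := h.nonneg u v (ha.trans_le hu.1) huv
      have i3 : 1 ≤ Real.exp (κ * (u - a)) :=
        Real.one_le_exp (mul_nonneg hκ0.le (sub_nonneg.2 hu.1))
      rw [pow_zero, div_one]
      nlinarith
    | succ n ih =>
      intro v hv u hu
      have := step _ (by positivity) ih v hv u hu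
      convert this using 2
      rw [pow_succ]
      field_simp
      ring
  have hlim : Tendsto (fun n : ℕ => (2 * D + E / 2 ^ n) * Real.exp (κ * (U - a))) atTop
      (nhds ((2 * D + 0) * Real.exp (κ * (U - a)))) := by
    refine Tendsto.mul_const _ (Tendsto.const_add _ ?_)
    exact tendsto_const_nhds.div_atTop (tendsto_pow_atTop_atTop_of_one_lt one_lt_two)
  have hfin := ge_of_tendsto' hlim fun n => iter n v₀ le_rfl U ⟨haU, hU⟩
  rw [add_zero] at hfin
  refine hfin.trans ?_
  have hle : κ * (U - a) ≤ 4 * K := by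
    rw [hκ, div_mul_eq_mul_div, div_le_iff₀ hv₀]
    exact mul_le_mul_of_nonneg_left (by linarith) (by positivity)
  exact mul_le_mul_of_nonneg_left (Real.exp_le_exp.2 hle) (by positivity)

/-- Up to a small error the potential has reached its limiting value in the region `u ≤ c * v`. -/
theorem exists_limit_sub_le (h : IsNullPotential J α β γ E) {F : ℝ → ℝ}
    (hF : ∀ u, 0 < u → Tendsto (J u) atTop (nhds (F u))) {c ε : ℝ} (hc0 : 0 < c) (hc1 : c < 1)
    (hε : 0 < ε) :
    ∃ a > 0, ∃ V > 0, ∀ v, V ≤ v → ∀ u, a ≤ u → u ≤ c * v → F a - ε ≤ J u v := by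
  have h1c : 0 < 1 - c := by linarith
  set K := 25 / (1 - c) ^ 2 with hK
  have hK0 : 0 < K := by positivity
  set B := 2 * Real.exp (4 * K) with hB
  have hB0 : 0 < B := by positivity
  set δ := ε / (2 * B) with hδ
  have hδ0 : 0 < δ := by positivity
  have hFnn : ∀ u, 0 < u → 0 ≤ F u := fun u hu =>
    (h.nonneg u (u + 1) hu (lt_add_one u)).trans (h.le_limit hF hu (lt_add_one u))
  have hbdd : BddBelow (image F (Ioi 0)) := ⟨0, by rintro _ ⟨u, hu, rfl⟩; exact hFnn u hu⟩
  obtain ⟨_, ⟨a, ha, rfl⟩, ha'⟩ := exists_lt_of_csInf_lt (s := image F (Ioi 0))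
    ⟨_, 1, mem_Ioi.2 one_pos, rfl⟩ (lt_add_of_pos_right _ hδ0)
  have ha0 : 0 < a := ha
  have hFδ : ∀ u, a ≤ u → F a ≤ F u + δ := fun u hu => by
    have := csInf_le hbdd ⟨u, ha0.trans_le hu, rfl⟩
    linarith
  set η := ε / (2 * (1 + B * K)) with hη
  have hη0 : 0 < η := by positivity
  obtain ⟨V, hV⟩ := eventually_atTop.1
    ((hF a ha0).eventually_const_le (sub_lt_self (F a) hη0))
  refine ⟨a, ha0, max V 1, by positivity, fun v hv u hau huv => ?_⟩
  have i1 := hV v ((le_max_left _ _).trans hv)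
  have i2 := h.drop_le_of_limit hF ha0 hc0 hc1 hFδ (hau.trans huv) hau huv
  have i3 : F a - J a v ≤ η := by linarith
  have i4 : 2 * (δ + K * (F a - J a v)) * Real.exp (4 * K) ≤ B * δ + B * K * η := by
    have : 2 * (δ + K * (F a - J a v)) * Real.exp (4 * K) = B * δ + B * K * (F a - J a v) := by
      rw [hB]; ring
    rw [this]
    gcongr
  have i5 : B * δ = ε / 2 := by rw [hδ]; field_simp
  have i6 : η + B * K * η = ε / 2 := by
    rw [hη]
    field_simp
  linarith

end IsNullPotential

/-- The derivative along a curve of a function with continuous partial derivatives. -/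
theorem hasDerivAt_curve_of_partial {g g₁ g₂ : ℝ → ℝ → ℝ}
    (h₁ : ∀ t r, 0 < t → 0 < r → HasDerivAt (fun s => g s r) (g₁ t r) t)
    (h₂ : ∀ t r, 0 < t → 0 < r → HasDerivAt (g t) (g₂ t r) r)
    (c₁ : SmoothOnQuadrant g₁) (c₂ : SmoothOnQuadrant g₂) {t r : ℝ} (ht : 0 < t) (hr : 0 < r)
    {x y : ℝ → ℝ} {x' y' s : ℝ} (hx : HasDerivAt x x' s) (hy : HasDerivAt y y' s)
    (hxs : x s = t) (hys : y s = r) :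
    HasDerivAt (fun σ => g (x σ) (y σ)) (x' * g₁ t r + y' * g₂ t r) s := by
  subst hxs hys
  have hc : ∀ {k : ℝ → ℝ → ℝ}, SmoothOnQuadrant k → ContinuousAt
      (fun p : ℝ × ℝ => ContinuousLinearMap.toSpanSingleton ℝ (k p.1 p.2)) (x s, y s) := fun hk =>
    (ContinuousLinearMap.toSpanSingletonCLE (𝕜 := ℝ) (E := ℝ)).continuous.continuousAt.comp
      (hk.continuousOn.continuousAt (quadrant_mem_nhds ht hr))
  have key := hasStrictFDerivAt_uncurry_coprod (𝕜 := ℝ) (u := (x s, y s)) (f := g)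
    (f₁ := fun t r => ContinuousLinearMap.toSpanSingleton ℝ (g₁ t r))
    (f₂ := fun t r => ContinuousLinearMap.toSpanSingleton ℝ (g₂ t r))
    (by
      filter_upwards [quadrant_mem_nhds ht hr] with p hp
      exact (h₁ p.1 p.2 hp.1 hp.2).hasFDerivAt)
    (by
      filter_upwards [quadrant_mem_nhds ht hr] with p hp
      exact (h₂ p.1 p.2 hp.1 hp.2).hasFDerivAt)
    (hc c₁) (hc c₂)
  have h3 : HasDerivAt (fun σ => (x σ, y σ)) (x', y') s := hx.prodMk hy
  refine (key.hasFDerivAt.comp_hasDerivAt s h3).congr_deriv ?_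
  simp [Function.HasUncurry.uncurry]

namespace IsEnergyWave

variable {ψ : ℝ → ℝ → ℝ} {E t r : ℝ}

theorem hasDerivAt_locE_time (h : IsEnergyWave ψ E) (ht : 0 < t) (hr : 0 < r) :
    HasDerivAt (fun s => locE ψ s 0 r) (eFlux ψ t r) t := by
  have ht2 : 0 < t / 2 := half_pos ht
  have hc := h.smooth.eFlux.continuousOn_time hr
  have h1 : HasDerivAt (fun s => locE ψ (t / 2) 0 r + ∫ x in (t / 2)..s, eFlux ψ x r)
      (eFlux ψ t r) t := by
    refine (intervalIntegral.integral_hasDerivAt_right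
      (h.smooth.eFlux.intervalIntegrable_time hr ht2 ht) ?_ ?_).const_add _
    · exact hc.stronglyMeasurableAtFilter isOpen_Ioi t ht
    · exact hc.continuousAt (Ioi_mem_nhds ht)
  refine h1.congr_of_eventuallyEq ?_
  filter_upwards [Ioi_mem_nhds (half_lt_self ht)] with s hs
  rw [← h.locE_time_sub ht2 (ht2.trans hs) (le_of_lt hs) hr]
  ring

theorem hasDerivAt_locE_curve (h : IsEnergyWave ψ E) (ht : 0 < t) (hr : 0 < r)
    {x y : ℝ → ℝ} {x' y' s : ℝ} (hx : HasDerivAt x x' s) (hy : HasDerivAt y y' s)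
    (hxs : x s = t) (hys : y s = r) :
    HasDerivAt (fun σ => locE ψ (x σ) 0 (y σ)) (x' * eFlux ψ t r + y' * eDen ψ t r) s :=
  hasDerivAt_curve_of_partial (g := fun t r => locE ψ t 0 r)
    (fun _ _ ht hr => h.hasDerivAt_locE_time ht hr) (fun _ _ ht hr => h.hasDerivAt_locE_radial ht hr)
    h.smooth.eFlux h.smooth.eDen ht hr hx hy hxs hys

theorem isNullPotential (h : IsEnergyWave ψ E) :
    IsNullPotential (fun u v => locE ψ ((u + v) / 2) 0 ((v - u) / 2))
      (fun u v => (eDen ψ ((u + v) / 2) ((v - u) / 2) + eFlux ψ ((u + v) / 2) ((v - u) / 2)) / 2)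
      (fun u v => (eDen ψ ((u + v) / 2) ((v - u) / 2) - eFlux ψ ((u + v) / 2) ((v - u) / 2)) / 2)
      (fun u v => (pR (eDen ψ) ((u + v) / 2) ((v - u) / 2)
        - pT (eFlux ψ) ((u + v) / 2) ((v - u) / 2)) / 4) E := by
  have dtv : ∀ u v : ℝ, HasDerivAt (fun v => (u + v) / 2) (1 / 2) v := fun u v =>
    ((hasDerivAt_id v).const_add u).div_const 2
  have drv : ∀ u v : ℝ, HasDerivAt (fun v => (v - u) / 2) (1 / 2) v := fun u v =>
    ((hasDerivAt_id v).sub_const u).div_const 2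
  have dtu : ∀ u v : ℝ, HasDerivAt (fun u => (u + v) / 2) (1 / 2) u := fun u v =>
    ((hasDerivAt_id u).add_const v).div_const 2
  have dru : ∀ u v : ℝ, HasDerivAt (fun u => (v - u) / 2) (-1 / 2) u := fun u v =>
    ((hasDerivAt_id u).const_sub v).div_const 2
  have hcont : ∀ {k : ℝ → ℝ → ℝ}, SmoothOnQuadrant k →
      ContinuousOn (fun p : ℝ × ℝ => k ((p.1 + p.2) / 2) ((p.2 - p.1) / 2))
        {p | 0 < p.1 ∧ p.1 < p.2} := fun hk =>
    hk.continuousOn_comp (by fun_prop) (by fun_prop)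
      (fun p hp => by obtain ⟨h1, h2⟩ := hp; linarith)
      (fun p hp => by obtain ⟨h1, h2⟩ := hp; linarith)
  have hab : ∀ u v : ℝ, u < v → |eFlux ψ ((u + v) / 2) ((v - u) / 2)| ≤
      eDen ψ ((u + v) / 2) ((v - u) / 2) := fun u v huv => abs_eFlux_le (by linarith)
  refine ⟨fun u v hu huv => ?_, fun u v hu huv => ?_, fun u v hu huv => ?_,
    ((hcont h.smooth.eDen).add (hcont h.smooth.eFlux)).div_const 2,
    ((hcont h.smooth.eDen).sub (hcont h.smooth.eFlux)).div_const 2,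
    ((hcont h.smooth.eDen.radial).sub (hcont h.smooth.eFlux.time)).div_const 4,
    fun u v hu huv => ?_, fun u v hu huv => ?_, fun u v hu huv => ?_, fun u v hu huv => ?_,
    fun u v hu huv => h.locE_le (by linarith) _⟩
  all_goals
    have ht : 0 < (u + v) / 2 := by linarith
    have hr : 0 < (v - u) / 2 := by linarith
  · refine (h.hasDerivAt_locE_curve ht hr (dtv u v) (drv u v) rfl rfl).congr_deriv ?_
    ring
  · refine (h.hasDerivAt_locE_curve ht hr (dtu u v) (dru u v) rfl rfl).congr_deriv ?_
    ring
  · refine (((h.smooth.eDen.hasDerivAt_curve ht hr (dtv u v) (drv u v) rfl rfl).sub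
      (h.smooth.eFlux.hasDerivAt_curve ht hr (dtv u v) (drv u v) rfl rfl)).div_const 2).congr_deriv ?_
    rw [h.pT_eDen ht hr]
    ring
  · linarith [neg_le_of_abs_le (hab u v huv)]
  · linarith [le_of_abs_le (hab u v huv)]
  · have := abs_nullForm_sq_le (ψ := ψ) (t := (u + v) / 2) hr
    rw [h.pT_eFlux ht hr]
    nlinarith
  · exact locE_nonneg le_rfl

end IsEnergyWave

/-- Fubini's theorem on a triangle. -/
theorem integral_triangle_swap {F : ℝ → ℝ → ℝ} {a ρ T : ℝ} (hT : a + ρ ≤ T)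
    (hF : ContinuousOn (fun p : ℝ × ℝ => F p.1 p.2) (Icc (a + ρ) T ×ˢ Icc ρ (T - a))) :
    IntervalIntegrable (fun t => ∫ r in ρ..(t - a), F t r) volume (a + ρ) T ∧
      ∫ t in (a + ρ)..T, ∫ r in ρ..(t - a), F t r = ∫ r in ρ..(T - a), ∫ t in (r + a)..T, F t r := by
  set S : Set (ℝ × ℝ) := {p | p.2 ≤ p.1 - a} with hS
  have hSm : MeasurableSet S := (isClosed_le continuous_snd (by fun_prop)).measurableSet
  have hint : IntegrableOn (S.indicator fun p : ℝ × ℝ => F p.1 p.2)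
      (Ioc (a + ρ) T ×ˢ Ioc ρ (T - a)) volume :=
    ((hF.integrableOn_compact (isCompact_Icc.prod isCompact_Icc)).mono_set
      (prod_mono Ioc_subset_Icc_self Ioc_subset_Icc_self)).indicator hSm
  rw [IntegrableOn, Measure.volume_eq_prod, ← Measure.prod_restrict] at hint
  have e1 : ∀ t ∈ Ioc (a + ρ) T, ∫ r in Ioc ρ (T - a), S.indicator (fun p => F p.1 p.2) (t, r) =
      ∫ r in ρ..(t - a), F t r := fun t ht => by
    have e : (fun r => S.indicator (fun p : ℝ × ℝ => F p.1 p.2) (t, r)) =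
        (Iic (t - a)).indicator (F t) := rfl
    rw [e, setIntegral_indicator measurableSet_Iic, intervalIntegral.integral_of_le (by linarith [ht.1]),
      Ioc_inter_Iic, min_eq_right (by linarith [ht.2])]
  have e2 : ∀ r ∈ Ioc ρ (T - a), ∫ t in Ioc (a + ρ) T, S.indicator (fun p => F p.1 p.2) (t, r) =
      ∫ t in (r + a)..T, F t r := fun r hr => by
    have e : (fun t => S.indicator (fun p : ℝ × ℝ => F p.1 p.2) (t, r)) =
        (Ici (r + a)).indicator (fun t => F t r) := by
      ext t
      simp only [indicator, hS, mem_ofPred_eq, mem_Ici, le_sub_iff_add_le]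
    have e' : Ioc (a + ρ) T ∩ Ici (r + a) = Icc (r + a) T := by
      ext t
      simp only [mem_inter_iff, mem_Ioc, mem_Ici, mem_Icc]
      constructor
      · rintro ⟨⟨_, h2⟩, h3⟩
        exact ⟨h3, h2⟩
      · rintro ⟨h1, h2⟩
        exact ⟨⟨by linarith [hr.1], h2⟩, h1⟩
    rw [e, setIntegral_indicator measurableSet_Ici, e', integral_Icc_eq_integral_Ioc,
      intervalIntegral.integral_of_le (by linarith [hr.2])]
  constructor
  · rw [intervalIntegrable_iff_integrableOn_Ioc_of_le hT]
    exact hint.integral_prod_left.congr (ae_restrict_of_forall_mem measurableSet_Ioc e1)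
  · rw [intervalIntegral.integral_of_le hT, intervalIntegral.integral_of_le (by linarith),
      ← setIntegral_congr_fun measurableSet_Ioc e1, ← setIntegral_congr_fun measurableSet_Ioc e2]
    exact integral_integral_swap (f := fun t r => S.indicator (fun p => F p.1 p.2) (t, r)) hint

namespace IsEnergyWave

variable {ψ : ℝ → ℝ → ℝ} {E t r : ℝ}

/-- The virial identity integrated over a truncated cone, away from the axis. -/
theorem integral_virial (h : IsEnergyWave ψ E) {a ρ T : ℝ} (ha : 0 < a) (hρ : 0 < ρ)
    (hT : a + ρ ≤ T) :
    IntervalIntegrable (fun t => ∫ r in ρ..(t - a), kinDen ψ t r) volume (a + ρ) T ∧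
    ∫ t in (a + ρ)..T, ∫ r in ρ..(t - a), kinDen ψ t r =
      (∫ t in (a + ρ)..T, (virialFlux ψ t (t - a) + virialDen ψ t (t - a)))
        - (∫ t in (a + ρ)..T, virialFlux ψ t ρ) - ∫ r in ρ..(T - a), virialDen ψ T r := by
  have hT0 : 0 < T := by linarith
  have hX := h.smooth.virialFlux
  have hY := h.smooth.virialDen
  have hrect : ∀ {k : ℝ → ℝ → ℝ}, SmoothOnQuadrant k →
      ContinuousOn (fun p : ℝ × ℝ => k p.1 p.2) (Icc (a + ρ) T ×ˢ Icc ρ (T - a)) := fun hk =>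
    hk.continuousOn.mono fun p hp => ⟨(by linarith : 0 < a + ρ).trans_le hp.1.1,
      hρ.trans_le hp.2.1⟩
  have hcone : ∀ {k : ℝ → ℝ → ℝ}, SmoothOnQuadrant k →
      IntervalIntegrable (fun t => k t (t - a)) volume (a + ρ) T := fun hk => by
    refine ContinuousOn.intervalIntegrable (hk.continuousOn_comp (by fun_prop) (by fun_prop)
      (fun t ht => ?_) fun t ht => ?_) <;>
    · rw [uIcc_of_le hT] at ht
      linarith [ht.1]
  obtain ⟨iK, -⟩ := integral_triangle_swap hT (hrect h.smooth.kinDen)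
  obtain ⟨iX, -⟩ := integral_triangle_swap hT (hrect hX.radial)
  obtain ⟨iY, eY⟩ := integral_triangle_swap hT (hrect hY.time)
  refine ⟨iK, ?_⟩
  have e0 : ∫ t in (a + ρ)..T, ∫ r in ρ..(t - a), kinDen ψ t r =
      (∫ t in (a + ρ)..T, ∫ r in ρ..(t - a), pR (virialFlux ψ) t r)
        - ∫ t in (a + ρ)..T, ∫ r in ρ..(t - a), pT (virialDen ψ) t r := by
    rw [← intervalIntegral.integral_sub iX iY]
    refine intervalIntegral.integral_congr fun t ht => ?_
    rw [uIcc_of_le hT] at ht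
    have ht0 : 0 < t := by linarith [ht.1]
    have hta : 0 < t - a := by linarith [ht.1]
    show _ = _ - _
    rw [← intervalIntegral.integral_sub (hX.radial.intervalIntegrable_radial ht0 hρ hta)
      (hY.time.intervalIntegrable_radial ht0 hρ hta)]
    exact intervalIntegral.integral_congr fun r hr =>
      h.virial ht0 (pos_of_mem_uIcc hρ hta hr)
  have e1 : ∫ t in (a + ρ)..T, ∫ r in ρ..(t - a), pR (virialFlux ψ) t r =
      (∫ t in (a + ρ)..T, virialFlux ψ t (t - a)) - ∫ t in (a + ρ)..T, virialFlux ψ t ρ := by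
    rw [← intervalIntegral.integral_sub (hcone hX)
      (hX.intervalIntegrable_time hρ (by linarith) hT0)]
    refine intervalIntegral.integral_congr fun t ht => ?_
    rw [uIcc_of_le hT] at ht
    exact hX.integral_pR (by linarith [ht.1]) hρ (by linarith [ht.1])
  have e2 : ∫ r in ρ..(T - a), ∫ t in (r + a)..T, pT (virialDen ψ) t r =
      (∫ r in ρ..(T - a), virialDen ψ T r) - ∫ t in (a + ρ)..T, virialDen ψ t (t - a) := by
    have e3 : ∫ t in (a + ρ)..T, virialDen ψ t (t - a) =
        ∫ r in ρ..(T - a), virialDen ψ (r + a) r := by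
      have := intervalIntegral.integral_comp_sub_right (a := a + ρ) (b := T)
        (fun r => virialDen ψ (r + a) r) a
      simpa using this
    have i3 : IntervalIntegrable (fun r => virialDen ψ (r + a) r) volume ρ (T - a) := by
      refine ContinuousOn.intervalIntegrable (hY.continuousOn_comp (by fun_prop) (by fun_prop)
        (fun t ht => ?_) fun t ht => ?_) <;>
      · rw [uIcc_of_le (by linarith)] at ht
        linarith [ht.1]
    rw [e3, ← intervalIntegral.integral_sub
      (hY.intervalIntegrable_radial hT0 hρ (by linarith)) i3]
    refine intervalIntegral.integral_congr fun r hr => ?_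
    rw [uIcc_of_le (by linarith)] at hr
    exact hY.integral_pT (by linarith [hr.1]) (by linarith [hr.1]) hT0
  rw [e0, e1, eY, e2, intervalIntegral.integral_add (hcone hX) (hcone hY)]
  ring

theorem integral_virial_le (h : IsEnergyWave ψ E) {a ρ T : ℝ} (ha : 0 < a) (hρ : 0 < ρ)
    (hT : a + ρ ≤ T) :
    2 * ∫ t in (a + ρ)..T, ∫ r in ρ..(t - a), kinDen ψ t r ≤
      2 * (T - a) * locE ψ T 0 (T - a) - (∫ t in (a + ρ)..T, locE ψ t 0 (t - a))
        - (∫ r in ρ..(T - a), locE ψ T 0 r) + ∫ t in (a + ρ)..T, (Real.sin (ψ t ρ)) ^ 2 := by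
  have hT0 : 0 < T := by linarith
  have haρ : 0 < a + ρ := by linarith
  have hTa : 0 < T - a := by linarith
  have hcone : ∀ {k : ℝ → ℝ → ℝ}, SmoothOnQuadrant k →
      ContinuousOn (fun t => k t (t - a)) (uIcc (a + ρ) T) := fun hk => by
    refine hk.continuousOn_comp (by fun_prop) (by fun_prop) (fun t ht => ?_) fun t ht => ?_ <;>
    · rw [uIcc_of_le hT] at ht
      linarith [ht.1]
  have hX := h.smooth.virialFlux
  have hY := h.smooth.virialDen
  have hj : ∀ t ∈ uIcc (a + ρ) T, HasDerivAt (fun t => locE ψ t 0 (t - a))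
      (eFlux ψ t (t - a) + eDen ψ t (t - a)) t := fun t ht => by
    rw [uIcc_of_le hT] at ht
    refine (h.hasDerivAt_locE_curve (t := t) (r := t - a) (by linarith [ht.1])
      (by linarith [ht.1]) (hasDerivAt_id t)
      ((hasDerivAt_id t).sub_const a) rfl rfl).congr_deriv ?_
    simp
  have hJ : ∀ r ∈ uIcc ρ (T - a), HasDerivAt (fun r => locE ψ T 0 r) (eDen ψ T r) r :=
    fun r hr => h.hasDerivAt_locE_radial hT0 (pos_of_mem_uIcc hρ hTa hr)
  have hjc : ContinuousOn (fun t => eFlux ψ t (t - a) + eDen ψ t (t - a)) (uIcc (a + ρ) T) :=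
    (hcone h.smooth.eFlux).add (hcone h.smooth.eDen)
  have p1 := intervalIntegral.integral_mul_deriv_eq_deriv_mul (u := fun t : ℝ => t - a)
    (u' := fun _ => 1) (fun t _ => (hasDerivAt_id t).sub_const a) hj (by simp)
    hjc.intervalIntegrable
  have p2 := intervalIntegral.integral_mul_deriv_eq_deriv_mul (u := fun r : ℝ => r)
    (u' := fun _ => 1) (fun t _ => hasDerivAt_id t) hJ (by simp)
    (h.smooth.eDen.intervalIntegrable_radial hT0 hρ hTa)
  have q1 : 2 * ∫ t in (a + ρ)..T, (virialFlux ψ t (t - a) + virialDen ψ t (t - a)) ≤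
      ∫ t in (a + ρ)..T, (t - a) * (eFlux ψ t (t - a) + eDen ψ t (t - a)) := by
    rw [← intervalIntegral.integral_const_mul]
    refine intervalIntegral.integral_mono_on hT
      (((hcone hX).add (hcone hY)).intervalIntegrable.const_mul 2)
      (ContinuousOn.mul (by fun_prop) hjc).intervalIntegrable fun t ht => ?_
    have hta : 0 < t - a := by linarith [ht.1]
    unfold virialFlux virialDen eFlux eDen
    have : (t - a) * ((Real.sin (ψ t (t - a))) ^ 2 / (t - a) ^ 2 * (t - a)) =
        (Real.sin (ψ t (t - a))) ^ 2 := by field_simp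
    nlinarith [sq_nonneg (Real.sin (ψ t (t - a)))]
  have q2 : -(2 * ∫ r in ρ..(T - a), virialDen ψ T r) ≤ ∫ r in ρ..(T - a), r * eDen ψ T r := by
    rw [← intervalIntegral.integral_const_mul, ← intervalIntegral.integral_neg]
    refine intervalIntegral.integral_mono_on (by linarith)
      ((hY.intervalIntegrable_radial hT0 hρ hTa).const_mul 2).neg
      ((SmoothOnQuadrant.radius.mul h.smooth.eDen).intervalIntegrable_radial hT0 hρ hTa)
      fun r hr => ?_
    have hr0 : 0 < r := hρ.trans_le hr.1
    have e : -(2 * virialDen ψ T r) = r * -(eFlux ψ T r) := by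
      unfold virialDen eFlux; ring
    rw [e]
    exact mul_le_mul_of_nonneg_left ((neg_le_abs _).trans (abs_eFlux_le hr0.le)) hr0.le
  have q3 : -(2 * ∫ t in (a + ρ)..T, virialFlux ψ t ρ) ≤
      ∫ t in (a + ρ)..T, (Real.sin (ψ t ρ)) ^ 2 := by
    rw [← intervalIntegral.integral_const_mul, ← intervalIntegral.integral_neg]
    refine intervalIntegral.integral_mono_on hT
      ((hX.intervalIntegrable_time hρ haρ hT0).const_mul 2).neg
      ((h.smooth.sin.pow 2).intervalIntegrable_time hρ haρ hT0) fun t _ => ?_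
    unfold virialFlux
    nlinarith [mul_nonneg (sq_nonneg ρ) (sq_nonneg (pT ψ t ρ)),
      mul_nonneg (sq_nonneg ρ) (sq_nonneg (pR ψ t ρ))]
  have n1 : 0 ≤ ρ * locE ψ (a + ρ) 0 ρ := mul_nonneg hρ.le (locE_nonneg le_rfl)
  have n2 : 0 ≤ ρ * locE ψ T 0 ρ := mul_nonneg hρ.le (locE_nonneg le_rfl)
  rw [(h.integral_virial ha hρ hT).2]
  simp only [one_mul, add_sub_cancel_left] at p1 p2
  linarith

end IsEnergyWave

namespace IsEnergyWave

variable {ψ : ℝ → ℝ → ℝ} {E t r : ℝ}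

theorem sin_sq_le_locE (h : IsEnergyWave ψ E) (ht : 0 < t) {ρ : ℝ} (hρ : 0 < ρ) :
    (Real.sin (ψ t ρ)) ^ 2 ≤ 3 * locE ψ t 0 (2 * ρ) := by
  have hlt : ρ < 2 * ρ := by linarith
  have hpos : ∀ x ∈ Icc ρ (2 * ρ), 0 < x := fun x hx => hρ.trans_le hx.1
  obtain ⟨ξ, hξ, hξe⟩ := exists_hasDerivAt_eq_slope (fun r => locE ψ t 0 r) (eDen ψ t) hlt
    (fun x hx => (h.hasDerivAt_locE_radial ht (hpos x hx)).continuousAt.continuousWithinAt)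
    (fun x hx => h.hasDerivAt_locE_radial ht (hρ.trans hx.1))
  have hξ0 : 0 < ξ := hρ.trans hξ.1
  have hmono := h.locE_mono ht hξ.2.le
  have h1 : (Real.sin (ψ t ξ)) ^ 2 ≤ 2 * (locE ψ t 0 (2 * ρ) - locE ψ t 0 ρ) := by
    have i1 := sin_sq_div_le_eDen (ψ := ψ) (t := t) hξ0
    have i2 : (locE ψ t 0 (2 * ρ) - locE ψ t 0 ρ) = ρ * eDen ψ t ξ := by
      rw [hξe]; field_simp; ring
    rw [div_le_iff₀ hξ0] at i1
    have i3 : 0 ≤ eDen ψ t ξ := eDen_nonneg hξ0.le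
    rw [i2]
    nlinarith [hξ.2]
  have hd : ∀ x, 0 < x → HasDerivAt (fun r => (Real.sin (ψ t r)) ^ 2 + locE ψ t 0 r)
      (2 * Real.sin (ψ t x) * (Real.cos (ψ t x) * pR ψ t x) + eDen ψ t x) x := fun x hx => by
    refine (((h.smooth.hasDerivAt_radial ht hx).sin.pow 2).add
      (h.hasDerivAt_locE_radial ht hx)).congr_deriv ?_
    simp
  have hm : MonotoneOn (fun r => (Real.sin (ψ t r)) ^ 2 + locE ψ t 0 r) (Ioi 0) := by
    refine monotoneOn_of_hasDerivWithinAt_nonneg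
      (f' := fun x => 2 * Real.sin (ψ t x) * (Real.cos (ψ t x) * pR ψ t x) + eDen ψ t x)
      (convex_Ioi 0) (fun x hx => (hd x hx).continuousAt.continuousWithinAt) ?_ ?_
    · intro x hx
      rw [interior_Ioi] at hx
      exact (hd x hx).hasDerivWithinAt
    · intro x hx
      rw [interior_Ioi] at hx
      have hx0 : 0 < x := hx
      set s := Real.sin (ψ t x)
      set c := Real.cos (ψ t x)
      set q := pR ψ t x
      have hc : c ^ 2 ≤ 1 := Real.cos_sq_le_one _
      have e : eDen ψ t x = (pT ψ t x) ^ 2 * x + ((q ^ 2 + (s / x) ^ 2) * x) := by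
        unfold eDen; rw [div_pow]; ring
      have e2 : 2 * s * (c * q) = 2 * (s / x) * (c * q) * x := by field_simp
      show 0 ≤ 2 * s * (c * q) + eDen ψ t x
      rw [e, e2]
      have i1 : 0 ≤ (pT ψ t x) ^ 2 * x := by positivity
      have i2 : 0 ≤ (2 * (s / x) * (c * q) + (q ^ 2 + (s / x) ^ 2)) * x := by
        refine mul_nonneg ?_ hx0.le
        nlinarith [sq_nonneg (s / x + c * q), sq_nonneg q]
      linarith
  have h2 := hm hρ hξ0 hξ.1.le
  simp only at h2
  linarith [locE_nonneg (ψ := ψ) (t := t) (r₂ := ρ) le_rfl]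

theorem continuousOn_locE_time (h : IsEnergyWave ψ E) (hr : 0 < r) :
    ContinuousOn (fun t => locE ψ t 0 r) (Ioi 0) := fun _ ht =>
  (h.hasDerivAt_locE_time ht hr).continuousAt.continuousWithinAt

theorem intervalIntegrable_locE_time (h : IsEnergyWave ψ E) (hr : 0 < r) {a b : ℝ} (ha : 0 < a)
    (hb : 0 < b) : IntervalIntegrable (fun t => locE ψ t 0 r) volume a b :=
  ((h.continuousOn_locE_time hr).mono fun _ hx => pos_of_mem_uIcc ha hb hx).intervalIntegrable

/-- On average in time, no energy sits at the axis. -/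
theorem tendsto_integral_locE_zero (h : IsEnergyWave ψ E) {a b : ℝ} (ha : 0 < a) (hb : 0 < b) :
    Tendsto (fun r => ∫ t in a..b, locE ψ t 0 r) (nhdsWithin 0 (Ioi 0)) (nhds 0) := by
  have : Tendsto (fun r => ∫ t in a..b, locE ψ t 0 r) (nhdsWithin 0 (Ioi 0))
      (nhds (∫ t in a..b, (0 : ℝ))) := by
    refine intervalIntegral.tendsto_integral_filter_of_dominated_convergence (fun _ => E) ?_ ?_
      (by simp) ?_
    · filter_upwards [self_mem_nhdsWithin] with r hr
      exact (intervalIntegrable_iff.1 (h.intervalIntegrable_locE_time hr ha hb)).aestronglyMeasurable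
    · filter_upwards with r
      filter_upwards with t ht
      rw [Real.norm_of_nonneg (locE_nonneg le_rfl)]
      exact h.locE_le (pos_of_mem_uIcc ha hb (uIoc_subset_uIcc ht)) r
    · filter_upwards with t ht
      exact h.tendsto_locE_zero (pos_of_mem_uIcc ha hb (uIoc_subset_uIcc ht))
  simpa using this

theorem kin_integrableOn (h : IsEnergyWave ψ E) (ht : 0 < t) :
    IntegrableOn (kinDen ψ t) (Ioi 0) volume := by
  refine Integrable.mono' (h.integrable t ht)
    ((h.smooth.kinDen.continuousOn_radial ht).aestronglyMeasurable measurableSet_Ioi)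
    (ae_restrict_of_forall_mem measurableSet_Ioi fun x hx => ?_)
  have hx0 : 0 < x := hx
  rw [Real.norm_of_nonneg (kinDen_nonneg hx0.le)]
  exact kinDen_le_eDen hx0.le

theorem integral_kin_nonneg : 0 ≤ ∫ x in Ioc 0 r, kinDen ψ t x :=
  setIntegral_nonneg measurableSet_Ioc fun _ hx => kinDen_nonneg hx.1.le

theorem integral_kin_le_locE (h : IsEnergyWave ψ E) (ht : 0 < t) :
    ∫ x in Ioc 0 r, kinDen ψ t x ≤ locE ψ t 0 r :=
  setIntegral_mono_on ((h.kin_integrableOn ht).mono_set fun _ hx => hx.1)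
    (h.integrableOn_Ioc ht le_rfl) measurableSet_Ioc fun _ hx => kinDen_le_eDen hx.1.le

theorem integral_kin_mono (h : IsEnergyWave ψ E) (ht : 0 < t) {r₁ r₂ : ℝ} (hr : r₁ ≤ r₂) :
    ∫ x in Ioc 0 r₁, kinDen ψ t x ≤ ∫ x in Ioc 0 r₂, kinDen ψ t x :=
  setIntegral_mono_set ((h.kin_integrableOn ht).mono_set fun _ hx => hx.1)
    (ae_restrict_of_forall_mem measurableSet_Ioc fun _ hx => kinDen_nonneg hx.1.le)
    (Eventually.of_forall fun _ hx => ⟨hx.1, hx.2.trans hr⟩)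

theorem integral_kin_le_add (h : IsEnergyWave ψ E) (ht : 0 < t) {ρ : ℝ} (hρ : 0 < ρ) (hr : ρ ≤ r) :
    ∫ x in Ioc 0 r, kinDen ψ t x ≤ locE ψ t 0 ρ + ∫ x in ρ..r, kinDen ψ t x := by
  have hu : Ioc 0 ρ ∪ Ioc ρ r = Ioc 0 r := Ioc_union_Ioc_eq_Ioc hρ.le hr
  rw [intervalIntegral.integral_of_le hr, ← hu, setIntegral_union
    (Ioc_disjoint_Ioc_of_le le_rfl) measurableSet_Ioc
    ((h.kin_integrableOn ht).mono_set fun _ hx => hx.1)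
    ((h.kin_integrableOn ht).mono_set fun _ hx => hρ.trans hx.1)]
  exact add_le_add_left (h.integral_kin_le_locE ht) _

theorem intervalIntegrable_integral_kin (h : IsEnergyWave ψ E) {a b c : ℝ} (ha : 0 ≤ a)
    (hb : 0 < b) (hc : 0 < c) :
    IntervalIntegrable (fun t => ∫ x in Ioc 0 (t - a), kinDen ψ t x) volume b c := by
  classical
  set S : Set (ℝ × ℝ) := {p | 0 < p.2} ∩ {p | p.2 ≤ p.1 - a} with hS
  have hSm : MeasurableSet S :=
    (isOpen_lt continuous_const continuous_snd).measurableSet.inter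
      (isClosed_le continuous_snd (by fun_prop)).measurableSet
  have hSq : S ⊆ quadrant := fun p hp => ⟨by
    have h1 : 0 < p.2 := hp.1
    have h2 : p.2 ≤ p.1 - a := hp.2
    show 0 < p.1
    linarith, hp.1⟩
  have hm : Measurable (S.piecewise (fun p : ℝ × ℝ => kinDen ψ p.1 p.2) fun _ => 0) :=
    ContinuousOn.measurable_piecewise (h.smooth.kinDen.continuousOn.mono hSq)
      continuousOn_const hSm
  have hsm := hm.stronglyMeasurable.integral_prod_right' (ν := (volume : Measure ℝ))
  have e : (fun t => ∫ x, S.piecewise (fun p : ℝ × ℝ => kinDen ψ p.1 p.2) (fun _ => 0) (t, x)) =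
      fun t => ∫ x in Ioc 0 (t - a), kinDen ψ t x := by
    ext t
    rw [← integral_indicator measurableSet_Ioc]
    congr 1
    ext x
    by_cases hx : x ∈ Ioc 0 (t - a)
    · rw [indicator_of_mem hx, piecewise_eq_of_mem _ _ _ (show (t, x) ∈ S from ⟨hx.1, hx.2⟩)]
    · rw [indicator_of_notMem hx, piecewise_eq_of_notMem _ _ _
        (show (t, x) ∉ S from fun hS' => hx ⟨hS'.1, hS'.2⟩)]
  rw [e] at hsm
  refine IntervalIntegrable.mono_fun' (g := fun _ => E) (by simp) hsm.aestronglyMeasurable ?_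
  refine ae_restrict_of_forall_mem measurableSet_uIoc fun t ht => ?_
  have ht0 := pos_of_mem_uIcc hb hc (uIoc_subset_uIcc ht)
  simp only
  rw [Real.norm_of_nonneg integral_kin_nonneg]
  exact (h.integral_kin_le_locE ht0).trans (h.locE_le ht0 _)

end IsEnergyWave

namespace IsEnergyWave

variable {ψ : ℝ → ℝ → ℝ} {E : ℝ}

theorem energy_nonneg (h : IsEnergyWave ψ E) : 0 ≤ E :=
  (locE_nonneg (ψ := ψ) (t := 1) (r₂ := 1) le_rfl).trans (h.locE_le one_pos 1)

theorem intervalIntegrable_locE_cone (h : IsEnergyWave ψ E) {a b c : ℝ} (ha : 0 < a)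
    (hb : a < b) (hc : a < c) :
    IntervalIntegrable (fun t => locE ψ t 0 (t - a)) volume b c := by
  refine ContinuousOn.intervalIntegrable fun t ht => ?_
  have hat : a < t := (lt_min hb hc).trans_le ht.1
  exact (h.hasDerivAt_locE_curve (t := t) (r := t - a) (ha.trans hat) (sub_pos.2 hat)
    (hasDerivAt_id t) ((hasDerivAt_id t).sub_const a) rfl rfl).continuousAt.continuousWithinAt

theorem intervalIntegrable_locE_radial (h : IsEnergyWave ψ E) {t a b : ℝ} (ht : 0 < t)
    (ha : 0 < a) (hb : 0 < b) : IntervalIntegrable (fun r => locE ψ t 0 r) volume a b :=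
  ContinuousOn.intervalIntegrable fun _ hr =>
    (h.hasDerivAt_locE_radial ht (pos_of_mem_uIcc ha hb hr)).continuousAt.continuousWithinAt

theorem integral_kin_cone_le (h : IsEnergyWave ψ E) {a ρ T : ℝ} (ha : 0 < a) (hρ : 0 < ρ)
    (hT : a + ρ ≤ T) :
    2 * ∫ t in a..T, ∫ r in Ioc 0 (t - a), kinDen ψ t r ≤
      2 * (T - a) * locE ψ T 0 (T - a) - (∫ t in (a + ρ)..T, locE ψ t 0 (t - a))
        - (∫ r in ρ..(T - a), locE ψ T 0 r)
        + (5 * (∫ t in a..T, locE ψ t 0 (2 * ρ)) + 2 * (E * ρ)) := by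
  have haρ : 0 < a + ρ := by linarith
  have hT0 : 0 < T := by linarith
  have h2ρ : 0 < 2 * ρ := by linarith
  have iK := (h.integral_virial ha hρ hT).1
  have iJ := h.intervalIntegrable_locE_time hρ haρ hT0
  have iJ2 := h.intervalIntegrable_locE_time h2ρ haρ hT0
  have e := intervalIntegral.integral_add_adjacent_intervals
    (h.intervalIntegrable_integral_kin ha.le ha haρ)
    (h.intervalIntegrable_integral_kin ha.le haρ hT0)
  have b1 : ∫ t in a..(a + ρ), ∫ r in Ioc 0 (t - a), kinDen ψ t r ≤ E * ρ := by
    have : ∫ t in a..(a + ρ), ∫ r in Ioc 0 (t - a), kinDen ψ t r ≤ ∫ t in a..(a + ρ), E :=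
      intervalIntegral.integral_mono_on (by linarith)
        (h.intervalIntegrable_integral_kin ha.le ha haρ) (by simp) fun t ht =>
        (h.integral_kin_le_locE (ha.trans_le ht.1)).trans (h.locE_le (ha.trans_le ht.1) _)
    simpa [mul_comm] using this
  have b2 : ∫ t in (a + ρ)..T, ∫ r in Ioc 0 (t - a), kinDen ψ t r ≤
      (∫ t in (a + ρ)..T, locE ψ t 0 (2 * ρ)) +
        ∫ t in (a + ρ)..T, ∫ r in ρ..(t - a), kinDen ψ t r := by
    rw [← intervalIntegral.integral_add iJ2 iK]
    refine intervalIntegral.integral_mono_on hT (h.intervalIntegrable_integral_kin ha.le haρ hT0)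
      (iJ2.add iK) fun t ht => ?_
    have ht0 : 0 < t := haρ.trans_le ht.1
    refine (h.integral_kin_le_add ht0 hρ (by linarith [ht.1])).trans ?_
    have := h.locE_mono ht0 (by linarith : ρ ≤ 2 * ρ)
    linarith
  have b3 : ∫ t in (a + ρ)..T, (Real.sin (ψ t ρ)) ^ 2 ≤
      3 * ∫ t in (a + ρ)..T, locE ψ t 0 (2 * ρ) := by
    rw [← intervalIntegral.integral_const_mul]
    exact intervalIntegral.integral_mono_on hT
      ((h.smooth.sin.pow 2).intervalIntegrable_time hρ haρ hT0) (iJ2.const_mul 3)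
      fun t ht => h.sin_sq_le_locE (haρ.trans_le ht.1) hρ
  have b4 : ∫ t in (a + ρ)..T, locE ψ t 0 (2 * ρ) ≤ ∫ t in a..T, locE ψ t 0 (2 * ρ) := by
    rw [← intervalIntegral.integral_add_adjacent_intervals
      (h.intervalIntegrable_locE_time h2ρ ha haρ) iJ2]
    have : 0 ≤ ∫ t in a..(a + ρ), locE ψ t 0 (2 * ρ) :=
      intervalIntegral.integral_nonneg (by linarith) fun _ _ => locE_nonneg le_rfl
    linarith
  have b5 := h.integral_virial_le ha hρ hT
  linarith

/-- The kinetic energy inside a truncated cone is small on average in time. -/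
theorem exists_integral_kin_cone_le (h : IsEnergyWave ψ E) {ε : ℝ} (hε : 0 < ε) :
    ∃ a > 0, ∃ C T₀ : ℝ, ∀ T, T₀ ≤ T →
      ∫ t in a..T, ∫ r in Ioc 0 (t - a), kinDen ψ t r ≤ ε * T + C := by
  have hE := h.energy_nonneg
  have hN := h.isNullPotential
  obtain ⟨F, hF⟩ := hN.exists_limit
  have hd : 0 < 2 * E + ε + 1 := by positivity
  set l := ε / (2 * E + ε + 1) with hl
  have hl0 : 0 < l := by positivity
  have hl1 : l < 1 := (div_lt_one hd).2 (by linarith)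
  have hlE : E * l ≤ ε / 2 := by
    rw [hl, mul_div_assoc', div_le_iff₀ hd]
    nlinarith
  obtain ⟨a, ha, V, hV, hFJ⟩ := hN.exists_limit_sub_le hF (c := (1 - l) / (1 + l)) (ε := ε / 2)
    (div_pos (by linarith) (by linarith)) ((div_lt_one (by linarith)).2 (by linarith))
    (half_pos hε)
  have hFE : F a ≤ E := by
    refine le_of_tendsto (hF a ha) ?_
    filter_upwards [eventually_gt_atTop a] with v hv
    exact hN.le a v ha hv
  have hJcone : ∀ t, locE ψ ((a + (2 * t - a)) / 2) 0 ((2 * t - a - a) / 2) =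
      locE ψ t 0 (t - a) := fun t => by
    congr 1 <;> ring
  have hjlim : Tendsto (fun t => locE ψ t 0 (t - a)) atTop (nhds (F a)) := by
    have h1 : Tendsto (fun t : ℝ => 2 * t - a) atTop atTop :=
      tendsto_atTop_add_const_right _ _ (tendsto_id.const_mul_atTop two_pos)
    exact ((hF a ha).comp h1).congr hJcone
  have hjle : ∀ t, a < t → locE ψ t 0 (t - a) ≤ F a := fun t ht => by
    rw [← hJcone t]
    exact hN.le_limit hF ha (by linarith)
  obtain ⟨t₀, ht₀⟩ := eventually_atTop.1
    (hjlim.eventually_const_le (sub_lt_self (F a) (half_pos hε)))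
  set t₁ := max t₀ (a + 1) with ht₁
  have ht₁a : a + 1 ≤ t₁ := le_max_right _ _
  refine ⟨a, ha, E * t₁, max (max V t₁) (a / (1 - l)), fun T hT => ?_⟩
  have hTV : V ≤ T := (le_max_left _ _).trans ((le_max_left _ _).trans hT)
  have hTt : t₁ ≤ T := (le_max_right _ _).trans ((le_max_left _ _).trans hT)
  have hTl : l * T ≤ T - a := by
    have := (le_max_right _ _).trans hT
    rw [div_le_iff₀ (by linarith)] at this
    linarith
  have hT0 : 0 < T := hV.trans_le hTV
  have hlT : 0 < l * T := by positivity
  set R := 2 * (T - a) * F a - (T - t₁) * (F a - ε / 2) - (T - a - l * T) * (F a - ε / 2) with hR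
  have hbd : ∀ᶠ ρ in nhdsWithin (0 : ℝ) (Ioi 0),
      2 * ∫ t in a..T, ∫ r in Ioc 0 (t - a), kinDen ψ t r ≤
        R + (5 * (∫ t in a..T, locE ψ t 0 (2 * ρ)) + 2 * (E * ρ)) := by
    filter_upwards [Ioo_mem_nhdsGT (lt_min one_pos hlT)] with ρ hρ
    have hρ0 : 0 < ρ := hρ.1
    have hρ1 : ρ < 1 := hρ.2.trans_le (min_le_left _ _)
    have hρl : ρ < l * T := hρ.2.trans_le (min_le_right _ _)
    have haT : a + ρ ≤ T := by linarith
    refine (h.integral_kin_cone_le ha hρ0 haT).trans ?_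
    have c1 : 2 * (T - a) * locE ψ T 0 (T - a) ≤ 2 * (T - a) * F a :=
      mul_le_mul_of_nonneg_left (hjle T (by linarith)) (by linarith)
    have c2 : (T - t₁) * (F a - ε / 2) ≤ ∫ t in (a + ρ)..T, locE ψ t 0 (t - a) := by
      rw [← intervalIntegral.integral_add_adjacent_intervals (b := t₁)
        (h.intervalIntegrable_locE_cone ha (by linarith) (by linarith))
        (h.intervalIntegrable_locE_cone ha (by linarith) (by linarith))]
      have d1 : 0 ≤ ∫ t in (a + ρ)..t₁, locE ψ t 0 (t - a) :=
        intervalIntegral.integral_nonneg (by linarith) fun _ _ => locE_nonneg le_rfl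
      have d2 : ∫ t in t₁..T, (F a - ε / 2) ≤ ∫ t in t₁..T, locE ψ t 0 (t - a) :=
        intervalIntegral.integral_mono_on hTt (by simp)
          (h.intervalIntegrable_locE_cone ha (by linarith) (by linarith))
          fun t ht => ht₀ t ((le_max_left _ _).trans ht.1)
      rw [intervalIntegral.integral_const, smul_eq_mul] at d2
      linarith
    have c3 : (T - a - l * T) * (F a - ε / 2) ≤ ∫ r in ρ..(T - a), locE ψ T 0 r := by
      rw [← intervalIntegral.integral_add_adjacent_intervals (b := l * T)
        (h.intervalIntegrable_locE_radial hT0 hρ0 hlT)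
        (h.intervalIntegrable_locE_radial hT0 hlT (by linarith))]
      have d1 : 0 ≤ ∫ r in ρ..(l * T), locE ψ T 0 r :=
        intervalIntegral.integral_nonneg hρl.le fun _ _ => locE_nonneg le_rfl
      have d2 : ∫ r in (l * T)..(T - a), (F a - ε / 2) ≤ ∫ r in (l * T)..(T - a), locE ψ T 0 r := by
        refine intervalIntegral.integral_mono_on hTl (by simp)
          (h.intervalIntegrable_locE_radial hT0 hlT (by linarith)) fun r hr => ?_
        have hr0 : 0 < r := hlT.trans_le hr.1
        have := hFJ (T + r) (by linarith) (T - r) (by linarith [hr.2]) (by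
          rw [div_mul_eq_mul_div, le_div_iff₀ (by linarith)]
          nlinarith [hr.1])
        have e1 : (T - r + (T + r)) / 2 = T := by ring
        have e2 : (T + r - (T - r)) / 2 = r := by ring
        rwa [e1, e2] at this
      rw [intervalIntegral.integral_const, smul_eq_mul] at d2
      linarith
    linarith
  have hlim : Tendsto (fun ρ => R + (5 * (∫ t in a..T, locE ψ t 0 (2 * ρ)) + 2 * (E * ρ)))
      (nhdsWithin (0 : ℝ) (Ioi 0)) (nhds (R + (5 * 0 + 2 * (E * 0)))) := by
    have h1 : Tendsto (fun ρ : ℝ => 2 * ρ) (nhdsWithin 0 (Ioi 0)) (nhdsWithin 0 (Ioi 0)) := by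
      refine tendsto_nhdsWithin_of_tendsto_nhds_of_eventually_within _ ?_ ?_
      · have : Tendsto (fun ρ : ℝ => 2 * ρ) (nhds 0) (nhds (2 * 0)) :=
          (continuous_const.mul continuous_id).tendsto 0
        rw [mul_zero] at this
        exact this.mono_left nhdsWithin_le_nhds
      · filter_upwards [self_mem_nhdsWithin] with ρ hρ
        exact mem_Ioi.2 (mul_pos two_pos (mem_Ioi.1 hρ))
    refine (((h.tendsto_integral_locE_zero ha hT0).comp h1).const_mul 5 |>.add
      ((tendsto_id.mono_left nhdsWithin_le_nhds).const_mul E |>.const_mul 2)).const_add R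
  have hfin := ge_of_tendsto hlim hbd
  have hRle : R ≤ E * t₁ + 3 / 2 * ε * T := by
    have r1 : R = F a * (t₁ - a + l * T) + (T - t₁) * (ε / 2) + (T - a - l * T) * (ε / 2) := by
      rw [hR]; ring
    have r2 : F a * (t₁ - a + l * T) ≤ E * (t₁ - a + l * T) :=
      mul_le_mul_of_nonneg_right hFE (by linarith)
    have r3 : E * l * T ≤ ε / 2 * T := mul_le_mul_of_nonneg_right hlE hT0.le
    nlinarith [mul_nonneg hE ha.le, mul_pos hε (ha.trans (by linarith : a < t₁)), mul_pos hε ha,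
      mul_pos hε hlT]
  have : 0 ≤ E * t₁ := mul_nonneg hE (by linarith)
  nlinarith [mul_pos hε hT0]

end IsEnergyWave

/-- A maximal-function argument: a function whose primitive has slow linear growth has small
forward averages from arbitrarily late times. -/
theorem exists_forall_integral_le {f : ℝ → ℝ} {a C T₀ ε : ℝ} (hε : 0 < ε)
    (hf : ∀ b c, a ≤ b → a ≤ c → IntervalIntegrable f volume b c)
    (hC : ∀ T, T₀ ≤ T → ∫ t in a..T, f t ≤ ε * T + C) (M : ℝ) :
    ∃ t, M ≤ t ∧ ∀ σ, 0 < σ → ∫ s in t..(t + σ), f s ≤ 2 * ε * σ := by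
  set m := max M (max a T₀) with hm
  have hMm : M ≤ m := le_max_left _ _
  have ham : a ≤ m := (le_max_left _ _).trans (le_max_right _ _)
  have hTm : T₀ ≤ m := (le_max_right _ _).trans (le_max_right _ _)
  set H : ℝ → ℝ := fun t => (∫ s in a..t, f s) - 2 * ε * t with hH
  set b := max m ((C - H m) / ε) with hb
  have hmb : m ≤ b := le_max_left _ _
  have hlate : ∀ t, b ≤ t → H t ≤ H m := fun t ht => by
    have h1 := (le_max_right m ((C - H m) / ε)).trans ht
    rw [div_le_iff₀ hε] at h1
    have h2 := hC t (hTm.trans (hmb.trans ht))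
    have h3 : H t = (∫ s in a..t, f s) - 2 * ε * t := rfl
    rw [h3]
    linarith
  have hcont : ContinuousOn H (Icc m b) := by
    have h1 : IntegrableOn f (uIcc a b) volume := by
      rw [uIcc_of_le (ham.trans hmb), ← intervalIntegrable_iff_integrableOn_Icc_of_le
        (ham.trans hmb)]
      exact hf a b le_rfl (ham.trans hmb)
    have h2 := intervalIntegral.continuousOn_primitive_interval h1
    rw [uIcc_of_le (ham.trans hmb)] at h2
    exact (h2.mono (Icc_subset_Icc_left ham)).sub (by fun_prop)
  obtain ⟨t, ht, hmax⟩ := isCompact_Icc.exists_isMaxOn ⟨m, left_mem_Icc.2 hmb⟩ hcont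
  refine ⟨t, hMm.trans ht.1, fun σ hσ => ?_⟩
  have hle : H (t + σ) ≤ H t := by
    rcases le_total (t + σ) b with h1 | h1
    · exact hmax ⟨by linarith [ht.1], h1⟩
    · exact (hlate _ h1).trans (hmax (left_mem_Icc.2 hmb))
  have hat : a ≤ t := ham.trans ht.1
  have hadd := intervalIntegral.integral_add_adjacent_intervals (hf a t le_rfl hat)
    (hf t (t + σ) hat (by linarith))
  simp only [hH] at hle
  linarith

/-- existence of a sequence of times along which the averaged kinetic energy in
truncated cones vanishes uniformly over all averaging windows. -/
theorem stmt7_good_time_sequence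
    (ψ : ℝ → ℝ → ℝ) (A : ℝ → ℝ)
    (hwm : IsWaveMap ψ) (hfe : FiniteEnergy ψ) (hcons : EnergyConserved ψ)
    (hApos : ∀ t : ℝ, 0 < t → 0 < A t)
    (hAmono : MonotoneOn A (Set.Ioi 0))
    (hAtop : Filter.Tendsto A Filter.atTop Filter.atTop)
    (hAle : ∀ t : ℝ, 0 < t → A t ≤ t) :
    ∃ tn : ℕ → ℝ, (∀ n, 0 < tn n) ∧
      Filter.Tendsto tn Filter.atTop Filter.atTop ∧
      ∀ ε > 0, ∃ N : ℕ, ∀ n : ℕ, N ≤ n → ∀ σ : ℝ, 0 < σ →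
        (1 / σ) * (∫ t in Set.Ioc (tn n) (tn n + σ),
          ∫ r in Set.Ioc 0 (t - A (tn n)), (pT ψ t r) ^ 2 * r) ≤ ε := by
  have h := hwm.isEnergyWave hfe hcons
  have key : ∀ n : ℕ, ∃ t : ℝ, (n : ℝ) + 1 ≤ t ∧ ∀ σ, 0 < σ →
      ∫ s in t..(t + σ), ∫ r in Ioc 0 (s - A t), kinDen ψ s r ≤ 2 * (1 / ((n : ℝ) + 1)) * σ := by
    intro n
    have hn : (0 : ℝ) < 1 / ((n : ℝ) + 1) := Nat.one_div_pos_of_nat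
    obtain ⟨a, ha, C, T₀, hC⟩ := h.exists_integral_kin_cone_le hn
    obtain ⟨T₁, hT₁⟩ := eventually_atTop.1 (hAtop.eventually_ge_atTop a)
    obtain ⟨t, ht, hσ⟩ := exists_forall_integral_le hn
      (fun b c hb hc => h.intervalIntegrable_integral_kin ha.le (ha.trans_le hb) (ha.trans_le hc))
      hC (max ((n : ℝ) + 1) T₁)
    have hnt : (n : ℝ) + 1 ≤ t := (le_max_left _ _).trans ht
    have ht0 : 0 < t := lt_of_lt_of_le (by positivity) hnt
    refine ⟨t, hnt, fun σ hσ0 => le_trans ?_ (hσ σ hσ0)⟩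
    have hAa : a ≤ A t := hT₁ t ((le_max_right _ _).trans ht)
    exact intervalIntegral.integral_mono_on (by linarith)
      (h.intervalIntegrable_integral_kin (ha.le.trans hAa) ht0 (by linarith))
      (h.intervalIntegrable_integral_kin ha.le ht0 (by linarith))
      fun s hs => h.integral_kin_mono (ht0.trans_le hs.1) (by linarith)
  choose tn htn hbd using key
  refine ⟨tn, fun n => lt_of_lt_of_le (by positivity) (htn n), ?_, fun ε hε => ?_⟩
  · exact tendsto_atTop_mono (fun n => (le_add_of_nonneg_right zero_le_one).trans (htn n))
      tendsto_natCast_atTop_atTop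
  · obtain ⟨N, hN⟩ := exists_nat_one_div_lt (half_pos hε)
    refine ⟨N, fun n hn σ hσ => ?_⟩
    have h1 := hbd n σ hσ
    rw [intervalIntegral.integral_of_le (by linarith)] at h1
    have h2 : 1 / ((n : ℝ) + 1) ≤ 1 / ((N : ℝ) + 1) := Nat.one_div_le_one_div hn
    rw [one_div, inv_mul_le_iff₀ hσ]
    refine h1.trans ?_
    nlinarith
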